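/- Let n ≥ 3, let q be a prime power, and let c be a code word of C_{n-1}(n,q) with (3q−6)θ_{n-2}+3 ≤ wt(c) ≤ B_{n,q}. Then every plane of PG(n,q) containing a 3-secant to supp(c) is a plane of type 𝒯. -/

import Mathlib

open scoped Classical

noncomputable section

namespace PGCode

open Projectivization

/-- The points of `PG(n, q)`, where the field `F` has order `q`. -/
abbrev Pt (F : Type) [Field F] (n : ℕ) := Projectivization F (Fin (n + 1) → F)

variable {F : Type} [Field F]

/-- A point of `PG(n,q)` lies in the projective subspace determined by a linear subspace `W`. -/
def ptIn {n : ℕ} (P : Pt F n) (W : Submodule F (Fin (n + 1) → F)) : Prop :=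
  Projectivization.submodule P ≤ W

/-- The set of points of the projective subspace determined by a linear subspace `W`. -/
def ptsIn {n : ℕ} (W : Submodule F (Fin (n + 1) → F)) : Set (Pt F n) :=
  {P | ptIn P W}

/-- The incidence vector (over `F_p = ZMod p`) of the projective subspace determined by `W`. -/
def incVec (p : ℕ) {n : ℕ} (W : Submodule F (Fin (n + 1) → F)) : Pt F n → ZMod p :=
  fun P => if ptIn P W then (1 : ZMod p) else 0

/-- The code `C_{n-1}(n,q)`: the `F_p`-span of the incidence vectors of all hyperplanes
(projective dimension `n-1`, i.e. linear dimension `n`). -/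
def code (F : Type) [Field F] (p n : ℕ) : Submodule (ZMod p) (Pt F n → ZMod p) :=
  Submodule.span (ZMod p)
    {v | ∃ W : Submodule F (Fin (n + 1) → F), Module.finrank F W = n ∧ v = incVec p W}

/-- The support of a word. -/
def supp {p n : ℕ} (v : Pt F n → ZMod p) : Set (Pt F n) := {P | v P ≠ 0}

/-- The weight of a word. -/
def wt {p n : ℕ} (v : Pt F n → ZMod p) : ℕ := (supp v).ncard

/-- The weight of the restriction of a word to the subspace determined by `W`. -/
def wtRes {p n : ℕ} (c : Pt F n → ZMod p) (W : Submodule F (Fin (n + 1) → F)) : ℕ :=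
  (ptsIn W ∩ supp c).ncard

/-- `θ_m = (q^(m+1) - 1)/(q - 1)`, with `θ_m = 0` for `m < 0`. -/
def theta (q : ℕ) (m : ℤ) : ℕ :=
  if m < 0 then 0 else ∑ i ∈ Finset.range (m.toNat + 1), q ^ i

/-- The bound `B_{n,q}` from the paper. -/
def B (n q : ℕ) : ℝ :=
  if q < 7 ∨ q = 8 ∨ q = 9 ∨ q = 16 ∨ q = 25 ∨ q = 27 ∨ q = 49 then
    2 * (q : ℝ) ^ (n - 1)
  else if q = 7 ∨ q = 11 ∨ q = 13 ∨ q = 17 then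
    (3 * q - Real.sqrt (6 * q) - 1 / 2) * (q : ℝ) ^ (n - 2)
  else if q = 19 ∨ q = 121 then
    (3 * q - Real.sqrt (6 * q) + 9 / 2) * (q : ℝ) ^ (n - 2)
  else if q = 29 ∨ q = 31 ∨ q = 32 then
    (4 * q - 4 * Real.sqrt q - 25 / 2) * (q : ℝ) ^ (n - 2)
  else
    (4 * q - Real.sqrt (8 * q) - 33 / 2) * (q : ℝ) ^ (n - 2)

/-- A line of `PG(n,q)`: a linear subspace of dimension `2`. -/
def IsLine {n : ℕ} (l : Submodule F (Fin (n + 1) → F)) : Prop := Module.finrank F l = 2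

/-- A plane of `PG(n,q)`: a linear subspace of dimension `3`. -/
def IsPlane {n : ℕ} (W : Submodule F (Fin (n + 1) → F)) : Prop := Module.finrank F W = 3

/-- The line `l` is an `α`-secant to `supp c`. -/
def secant {p n : ℕ} (c : Pt F n → ZMod p) (l : Submodule F (Fin (n + 1) → F)) (α : ℕ) : Prop :=
  IsLine l ∧ (ptsIn l ∩ supp c).ncard = α

/-- The restriction of `c` to the plane `W` is a linear combination of at most two lines of `W`. -/
def TwoLineComb (p : ℕ) {n : ℕ} (c : Pt F n → ZMod p) (W : Submodule F (Fin (n + 1) → F)) :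
    Prop :=
  ∃ l₁ l₂ : Submodule F (Fin (n + 1) → F), IsLine l₁ ∧ IsLine l₂ ∧ l₁ ≤ W ∧ l₂ ≤ W ∧
    ∃ a b : ZMod p, ∀ P : Pt F n, ptIn P W → c P = a * incVec p l₁ P + b * incVec p l₂ P

/-- Type `T^△`: the restriction of `c` to the plane `W` is a linear combination (with nonzero
coefficients) of three nonconcurrent lines of `W`. -/
def TypeTri (p : ℕ) {n : ℕ} (c : Pt F n → ZMod p) (W : Submodule F (Fin (n + 1) → F)) : Prop :=
  ∃ l₁ l₂ l₃ : Submodule F (Fin (n + 1) → F),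
    IsLine l₁ ∧ IsLine l₂ ∧ IsLine l₃ ∧ l₁ ≤ W ∧ l₂ ≤ W ∧ l₃ ≤ W ∧
    l₁ ≠ l₂ ∧ l₁ ≠ l₃ ∧ l₂ ≠ l₃ ∧
    (¬ ∃ P : Pt F n, ptIn P l₁ ∧ ptIn P l₂ ∧ ptIn P l₃) ∧
    ∃ a₁ a₂ a₃ : ZMod p, a₁ ≠ 0 ∧ a₂ ≠ 0 ∧ a₃ ≠ 0 ∧
      ∀ P : Pt F n, ptIn P W →
        c P = a₁ * incVec p l₁ P + a₂ * incVec p l₂ P + a₃ * incVec p l₃ P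

/-- Type `T^★`: the restriction of `c` to the plane `W` is a linear combination (with nonzero
coefficients) of three distinct concurrent lines of `W`. -/
def TypeStar (p : ℕ) {n : ℕ} (c : Pt F n → ZMod p) (W : Submodule F (Fin (n + 1) → F)) : Prop :=
  ∃ l₁ l₂ l₃ : Submodule F (Fin (n + 1) → F),
    IsLine l₁ ∧ IsLine l₂ ∧ IsLine l₃ ∧ l₁ ≤ W ∧ l₂ ≤ W ∧ l₃ ≤ W ∧
    l₁ ≠ l₂ ∧ l₁ ≠ l₃ ∧ l₂ ≠ l₃ ∧
    (∃ P : Pt F n, ptIn P l₁ ∧ ptIn P l₂ ∧ ptIn P l₃) ∧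
    ∃ a₁ a₂ a₃ : ZMod p, a₁ ≠ 0 ∧ a₂ ≠ 0 ∧ a₃ ≠ 0 ∧
      ∀ P : Pt F n, ptIn P W →
        c P = a₁ * incVec p l₁ P + a₂ * incVec p l₂ P + a₃ * incVec p l₃ P

/-- The base code word `c₀` of the `T^odd` construction on `PG(2,p)`:
`c₀(0,1,a) = a`, `c₀(1,0,b) = b`, `c₀(1,1,c) = -c`, and `c₀ = 0` elsewhere. -/
def oddBase (p : ℕ) [Fact p.Prime] : Pt (ZMod p) 2 → ZMod p := fun P =>
  if P.rep 0 = 0 ∧ P.rep 1 ≠ 0 then P.rep 2 / P.rep 1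
  else if P.rep 1 = 0 ∧ P.rep 0 ≠ 0 then P.rep 2 / P.rep 0
  else if P.rep 0 = P.rep 1 ∧ P.rep 0 ≠ 0 then -(P.rep 2 / P.rep 0)
  else 0

/-- The line `m : X₀ = 0` of `PG(2,p)`. -/
def lineM1 (p : ℕ) [Fact p.Prime] : Submodule (ZMod p) (Fin 3 → ZMod p) :=
  LinearMap.ker (LinearMap.proj 0 : (Fin 3 → ZMod p) →ₗ[ZMod p] ZMod p)

/-- The line `m' : X₁ = 0` of `PG(2,p)`. -/
def lineM2 (p : ℕ) [Fact p.Prime] : Submodule (ZMod p) (Fin 3 → ZMod p) :=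
  LinearMap.ker (LinearMap.proj 1 : (Fin 3 → ZMod p) →ₗ[ZMod p] ZMod p)

/-- The line `m'' : X₀ = X₁` of `PG(2,p)`. -/
def lineM3 (p : ℕ) [Fact p.Prime] : Submodule (ZMod p) (Fin 3 → ZMod p) :=
  LinearMap.ker ((LinearMap.proj 0 : (Fin 3 → ZMod p) →ₗ[ZMod p] ZMod p) - LinearMap.proj 1)

/-- The code word `d = (γ c₀ + λ m + λ' m' + λ'' m'')^π` of the `T^odd` construction, where the
collineation `π` of `PG(2,p)` is the inverse of the homography induced by the linear
equivalence `g`. -/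
def oddWord (p : ℕ) [Fact p.Prime] (g : (Fin 3 → ZMod p) ≃ₗ[ZMod p] (Fin 3 → ZMod p))
    (γ lam lam' lam'' : ZMod p) : Pt (ZMod p) 2 → ZMod p := fun P =>
  γ * oddBase p (Projectivization.map g.toLinearMap g.injective P) +
    lam * incVec p (lineM1 p) (Projectivization.map g.toLinearMap g.injective P) +
    lam' * incVec p (lineM2 p) (Projectivization.map g.toLinearMap g.injective P) +
    lam'' * incVec p (lineM3 p) (Projectivization.map g.toLinearMap g.injective P)

/-- The semilinear embedding of `PG(2,p)` onto the plane of `PG(n,q)` spanned by the linearly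
independent vectors `b 0, b 1, b 2`, relative to the field embedding `σ : F_p → F`. -/
def planeEmbed {n : ℕ} {p : ℕ} [Fact p.Prime] (σ : ZMod p →+* F)
    (b : Fin 3 → (Fin (n + 1) → F)) (hb : LinearIndependent F b) :
    Pt (ZMod p) 2 → Pt F n := fun P =>
  Projectivization.mk F (∑ i, σ (P.rep i) • b i) (by
    intro hzero
    have h0 : ∀ i ∈ Finset.univ, σ (P.rep i) = 0 :=
      linearIndependent_iff'.mp hb Finset.univ (fun i => σ (P.rep i)) hzero
    have h1 : P.rep = 0 := funext fun i => σ.injective (by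
      simp only [Pi.zero_apply, map_zero]; exact h0 i (Finset.mem_univ i))
    exact P.rep_nonzero h1)

/-- Type `T^odd`: this requires `q = p` to be prime (`|F| = p`), and `c` restricted to the plane
`W` (spanned by the frame `b`) must coincide, via a semilinear identification of `W` with
`PG(2,p)`, with a code word `d` of the `T^odd` construction. -/
def TypeOdd (p : ℕ) [Fact p.Prime] [Fintype F] {n : ℕ} (c : Pt F n → ZMod p)
    (W : Submodule F (Fin (n + 1) → F)) : Prop :=
  Fintype.card F = p ∧
  ∃ (σ : ZMod p →+* F) (b : Fin 3 → (Fin (n + 1) → F)) (hb : LinearIndependent F b),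
    Submodule.span F (Set.range b) = W ∧
    ∃ (g : (Fin 3 → ZMod p) ≃ₗ[ZMod p] (Fin 3 → ZMod p)) (γ lam lam' lam'' : ZMod p), γ ≠ 0 ∧
      ∀ Q : Pt (ZMod p) 2, c (planeEmbed σ b hb Q) = oddWord p g γ lam lam' lam'' Q

/-- The list of plane types `T_0, T_{q+1}, T_{2q}, T_{2q+1}, T^odd, T^△, T^★`. -/
inductive PlaneT : Type where
  | T0 | Tq1 | T2q | T2q1 | Todd | Ttri | Tstar
deriving DecidableEq

/-- The restriction of `c` to the plane `W` is a code word of the given type. -/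
def PlaneIsType (p q : ℕ) [Fact p.Prime] [Fintype F] {n : ℕ} (c : Pt F n → ZMod p)
    (W : Submodule F (Fin (n + 1) → F)) : PlaneT → Prop
  | .T0 => TwoLineComb p c W ∧ wtRes c W = 0
  | .Tq1 => TwoLineComb p c W ∧ wtRes c W = q + 1
  | .T2q => TwoLineComb p c W ∧ wtRes c W = 2 * q
  | .T2q1 => TwoLineComb p c W ∧ wtRes c W = 2 * q + 1
  | .Todd => TypeOdd p c W
  | .Ttri => TypeTri p c W
  | .Tstar => TypeStar p c W

/-- The plane `W` is of type `𝒯`. -/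
def TypeT (p q : ℕ) [Fact p.Prime] [Fintype F] {n : ℕ} (c : Pt F n → ZMod p)
    (W : Submodule F (Fin (n + 1) → F)) : Prop :=
  IsPlane W ∧ ∃ t : PlaneT, PlaneIsType p q c W t

/-- The plane `W` is of type `𝒪`. -/
def TypeO (p q : ℕ) [Fact p.Prime] [Fintype F] {n : ℕ} (c : Pt F n → ZMod p)
    (W : Submodule F (Fin (n + 1) → F)) : Prop :=
  IsPlane W ∧ ¬ TypeT p q c W

/-- The restriction of `c` to the `k`-space `Sp` (linear dimension `k+1`) is of type `t`:
there is a `(k-3)`-space `κ ⊆ Sp` on which `c` is a scalar multiple of the all-one function,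
a plane `π ⊆ Sp` of type `t` disjoint from `κ`, and `c P = c (⟨κ, P⟩ ∩ π)` for every point
`P` of `Sp` outside `κ`. -/
def SpaceIsType (p q : ℕ) [Fact p.Prime] [Fintype F] {n : ℕ} (c : Pt F n → ZMod p)
    (Sp : Submodule F (Fin (n + 1) → F)) (k : ℕ) (t : PlaneT) : Prop :=
  Module.finrank F Sp = k + 1 ∧
  ∃ κ : Submodule F (Fin (n + 1) → F), Module.finrank F κ = k - 2 ∧ κ ≤ Sp ∧
    (∃ a : ZMod p, ∀ P : Pt F n, ptIn P κ → c P = a) ∧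
    ∃ π : Submodule F (Fin (n + 1) → F), IsPlane π ∧ π ≤ Sp ∧ π ⊓ κ = ⊥ ∧
      PlaneIsType p q c π t ∧
      ∀ P : Pt F n, ptIn P Sp → ¬ ptIn P κ →
        ∃ Q : Pt F n, ptIn Q π ∧
          Projectivization.submodule Q ≤ κ ⊔ Projectivization.submodule P ∧ c P = c Q

section Hankel

open Polynomial Matrix

variable {K : Type} [Field K]

/-- The Hankel matrix of moments of a family of polynomials indexed by a finite field. -/
def hankel [Fintype K] (f : K → K[X]) (s : ℕ) : Matrix (Fin s) (Fin s) K[X] :=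
  Matrix.of fun e i => ∑ x : K, C (x ^ ((e : ℕ) + i)) * f x

lemma natDegree_hankel_le [Fintype K] (a : ℕ → K[X])
    (ha : ∀ l, (a l).natDegree ≤ Fintype.card K - 1 - l) (s : ℕ) (e i : Fin s) :
    (hankel (fun x => ∑ l ∈ Finset.range (Fintype.card K), a l * C (x ^ l)) s e i).natDegree
      ≤ (e : ℕ) + i := by
  have h : hankel (fun x => ∑ l ∈ Finset.range (Fintype.card K), a l * C (x ^ l)) s e i
      = ∑ l ∈ Finset.range (Fintype.card K), a l * C (∑ x : K, x ^ ((e : ℕ) + i + l)) := by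
    simp only [hankel, Matrix.of_apply, Finset.mul_sum, map_sum]
    rw [Finset.sum_comm]
    refine Finset.sum_congr rfl fun l _ => Finset.sum_congr rfl fun x _ => ?_
    rw [pow_add x ((e : ℕ) + i) l, C_mul]
    ring
  rw [h]
  refine natDegree_sum_le_of_forall_le _ _ fun l hl => ?_
  by_cases hlt : (e : ℕ) + i + l < Fintype.card K - 1
  · rw [FiniteField.sum_pow_lt_card_sub_one K _ hlt]
    simp
  · refine (natDegree_mul_C_le _ _).trans ((ha l).trans ?_)
    omega

lemma natDegree_det_hankel_le [Fintype K] (a : ℕ → K[X])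
    (ha : ∀ l, (a l).natDegree ≤ Fintype.card K - 1 - l) (s : ℕ) :
    (hankel (fun x => ∑ l ∈ Finset.range (Fintype.card K), a l * C (x ^ l)) s).det.natDegree
      ≤ s * (s - 1) := by
  rw [Matrix.det_apply]
  refine natDegree_sum_le_of_forall_le _ _ fun σ _ => ?_
  refine (natDegree_smul_le _ _).trans ((natDegree_prod_le _ _).trans ?_)
  refine (Finset.sum_le_sum fun i _ => natDegree_hankel_le a ha s (σ i) i).trans ?_
  rw [Finset.sum_add_distrib, Equiv.sum_comp σ (fun i : Fin s => (i : ℕ)),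
    Fin.sum_univ_eq_sum_range (fun i => i) s, ← Finset.sum_range_id_mul_two]
  omega

lemma eval_det_hankel_ne_zero [Fintype K] (f : K → K[X]) (y : K) :
    (hankel f (Finset.univ.filter fun x => (f x).eval y ≠ 0).card).det.eval y ≠ 0 := by
  set S := Finset.univ.filter fun x => (f x).eval y ≠ 0 with hS
  let e : Fin S.card ≃ S := S.equivFin.symm
  let V := Matrix.vandermonde fun i => (e i : K)
  have hM : (hankel f S.card).map (eval y)
      = Vᵀ * Matrix.diagonal (fun i => (f (e i)).eval y) * V := by
    ext a b
    rw [Matrix.mul_apply]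
    simp only [Matrix.mul_diagonal, Matrix.transpose_apply, V, Matrix.vandermonde_apply,
      Matrix.map_apply, hankel, Matrix.of_apply, eval_finsetSum, eval_mul, eval_C]
    rw [Equiv.sum_comp e (fun x : S => (x : K) ^ (a : ℕ) * (f x).eval y * (x : K) ^ (b : ℕ)),
      Finset.sum_coe_sort S (fun x : K => x ^ (a : ℕ) * (f x).eval y * x ^ (b : ℕ))]
    generalize (a : ℕ) = i
    generalize (b : ℕ) = j
    rw [hS, Finset.sum_filter]
    refine Finset.sum_congr rfl fun x _ => ?_
    by_cases hx : (f x).eval y = 0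
    · simp [hx]
    · simp only [hx, ne_eq, not_false_eq_true, if_true]; ring
  have hdet : (hankel f S.card).det.eval y = ((hankel f S.card).map (eval y)).det := by
    have := RingHom.map_det (evalRingHom y) (hankel f S.card)
    simpa using this
  rw [hdet, hM, Matrix.det_mul, Matrix.det_mul, Matrix.det_transpose, Matrix.det_diagonal]
  have hV : V.det ≠ 0 := Matrix.det_vandermonde_ne_zero_iff.mpr
    fun i j h => e.injective (Subtype.ext h)
  refine mul_ne_zero (mul_ne_zero hV (Finset.prod_ne_zero_iff.mpr fun i _ => ?_)) hV
  exact (Finset.mem_filter.mp (e i).2).2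

lemma pow_dvd_det_hankel [Fintype K] (f : K → K[X]) (s : ℕ) (y : K) :
    (X - C y) ^ (s - (Finset.univ.filter fun x => (f x).eval y ≠ 0).card) ∣
      (hankel f s).det := by
  set S := Finset.univ.filter fun x => (f x).eval y ≠ 0 with hS
  let w : K[X] := ∏ x ∈ S, (X - C x)
  have hw : w.Monic := monic_prod_of_monic _ _ fun x _ => monic_X_sub_C x
  have hwd : w.natDegree = S.card := by
    simp [w, natDegree_prod_of_monic S (fun x => X - C x) fun x _ => monic_X_sub_C x]
  let B : Fin s → K[X] := fun i =>
    if S.card ≤ i then X ^ ((i : ℕ) - S.card) * w else X ^ (i : ℕ)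
  have hBm : ∀ i, (B i).Monic := fun i => by
    by_cases h : S.card ≤ i
    · simp only [B, h, if_true]; exact (monic_X_pow _).mul hw
    · simp only [B, h, if_false]; exact monic_X_pow _
  have hBd : ∀ i, (B i).natDegree = i := fun i => by
    by_cases h : S.card ≤ i
    · simp only [B, h, if_true]
      rw [(monic_X_pow _).natDegree_mul hw, hwd, natDegree_X_pow]; omega
    · simp only [B, h, if_false]; exact natDegree_X_pow _
  let T : Matrix (Fin s) (Fin s) K := Matrix.of fun i j : Fin s => (B j).coeff i
  have hT : T.det = 1 := Matrix.det_matrixOfPolynomials B hBd hBm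
  let T' : Matrix (Fin s) (Fin s) K[X] := T.map C
  have hT' : T'.det = 1 := by
    have := RingHom.map_det (C : K →+* K[X]) T
    rw [hT, map_one] at this
    exact this.symm
  have hprod : ∀ e j, (hankel f s * T') e j
      = ∑ x : K, C (x ^ (e : ℕ) * (B j).eval x) * f x := by
    intro e j
    simp only [Matrix.mul_apply, hankel, Matrix.of_apply, T', T, Matrix.map_apply, Finset.sum_mul]
    rw [Finset.sum_comm]
    refine Finset.sum_congr rfl fun x _ => ?_
    have : (B j).eval x = ∑ i : Fin s, (B j).coeff i * x ^ (i : ℕ) := by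
      rw [eval_eq_sum_range' (n := s) (by rw [hBd]; exact j.2),
        Fin.sum_univ_eq_sum_range (fun i => (B j).coeff i * x ^ i) s]
    rw [this, Finset.mul_sum, map_sum, Finset.sum_mul]
    refine Finset.sum_congr rfl fun i _ => ?_
    rw [pow_add]; simp only [C_mul]; ring
  have hdvd : ∀ e j : Fin s, S.card ≤ j → (X - C y) ∣ (hankel f s * T') e j := by
    intro e j hj
    rw [dvd_iff_isRoot, IsRoot, hprod, eval_finsetSum]
    refine Finset.sum_eq_zero fun x _ => ?_
    rw [eval_mul, eval_C]
    by_cases hx : (f x).eval y = 0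
    · rw [hx, mul_zero]
    · have hxS : x ∈ S := by rw [hS]; simpa using hx
      have : w.eval x = 0 := by
        rw [eval_prod]; exact Finset.prod_eq_zero hxS (by simp)
      simp [B, hj, this]
  have hdet : (hankel f s).det = (hankel f s * T').det := by rw [Matrix.det_mul, hT', mul_one]
  rw [hdet, Matrix.det_apply]
  refine Finset.dvd_sum fun σ _ => ?_
  refine Dvd.dvd.trans ?_ (Dvd.intro_left ((Equiv.Perm.sign σ : ℤ) : K[X]) (by
    rw [Units.smul_def, zsmul_eq_mul]))
  calc (X - C y) ^ (s - S.card) ∣ ∏ j ∈ Finset.univ.filter (fun j : Fin s => S.card ≤ j),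
          (X - C y) := by
        rw [Finset.prod_const]
        refine pow_dvd_pow _ ?_
        have h1 : (Finset.univ.filter fun j : Fin s => (j : ℕ) < S.card).card ≤ S.card := by
          refine (Finset.card_le_card_of_injOn (fun j : Fin s => (j : ℕ)) (t := Finset.range S.card)
            (fun j hj => ?_) (fun a _ b _ h => Fin.ext h)).trans (by simp)
          simpa using hj
        have h2 := Finset.card_filter_add_card_filter_not (s := (Finset.univ : Finset (Fin s)))
          (fun j : Fin s => S.card ≤ j)
        simp only [not_le, Finset.card_univ, Fintype.card_fin] at h2
        omega
    _ ∣ ∏ j ∈ Finset.univ.filter (fun j : Fin s => S.card ≤ j), (hankel f s * T') (σ j) j :=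
        Finset.prod_dvd_prod_of_dvd _ _ fun j hj => hdvd _ _ (Finset.mem_filter.mp hj).2
    _ ∣ _ := Finset.prod_dvd_prod_of_subset _ _ _ (Finset.filter_subset _ _)

/-- A bivariate polynomial of total degree less than `q` over the field of order `q` which is
nonzero at exactly `s` points of a line is nonzero at at least `s (q + 1 - s)` points. -/
theorem mul_le_card_ne_zero [Fintype K] (a : ℕ → K[X])
    (ha : ∀ l, (a l).natDegree ≤ Fintype.card K - 1 - l) (N : K → ℕ)
    (hN : ∀ y, N y = (Finset.univ.filter fun x : K =>
      ∑ l ∈ Finset.range (Fintype.card K), (a l).eval y * x ^ l ≠ 0).card) (y : K) :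
    N y * (Fintype.card K + 1 - N y) ≤ ∑ z : K, N z := by
  let f : K → K[X] := fun x => ∑ l ∈ Finset.range (Fintype.card K), a l * C (x ^ l)
  have hf : ∀ x z, (f x).eval z = ∑ l ∈ Finset.range (Fintype.card K), (a l).eval z * x ^ l := by
    intro x z; simp [f, eval_finsetSum]
  simp only [← hf] at hN
  have hle : N y ≤ Fintype.card K := by rw [hN]; exact Finset.card_le_univ _
  have hne : (hankel f (N y)).det ≠ 0 := by
    intro h0
    have := eval_det_hankel_ne_zero f y
    rw [← hN, h0] at this
    simp at this
  have hmult : ∀ z, N y - N z ≤ (hankel f (N y)).det.roots.count z := by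
    intro z
    rw [count_roots, le_rootMultiplicity_iff hne, hN z]
    exact pow_dvd_det_hankel f (N y) z
  have hsum : ∑ z : K, (N y - N z) ≤ N y * (N y - 1) := by
    calc ∑ z : K, (N y - N z) ≤ ∑ z : K, (hankel f (N y)).det.roots.count z :=
          Finset.sum_le_sum fun z _ => hmult z
      _ = Multiset.card (hankel f (N y)).det.roots := Multiset.sum_count_eq_card (by simp)
      _ ≤ _ := (card_roots' _).trans (natDegree_det_hankel_le a ha _)
  have htot : Fintype.card K * N y ≤ ∑ z : K, N z + ∑ z : K, (N y - N z) := by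
    rw [← Finset.sum_add_distrib]
    calc Fintype.card K * N y = ∑ _z : K, N y := by simp
      _ ≤ _ := Finset.sum_le_sum fun z _ => by omega
  rcases Nat.eq_zero_or_pos (N y) with h0 | hpos
  · simp [h0]
  · obtain ⟨k, hk⟩ := Nat.exists_eq_add_of_le hle
    obtain ⟨m, hm⟩ := Nat.exists_eq_add_of_lt hpos
    have e1 : Fintype.card K + 1 - N y = k + 1 := by omega
    have e2 : N y - 1 = m := by omega
    rw [e1]
    rw [e2] at hsum
    rw [hk] at htot
    have : N y = m + 1 := by omega
    nlinarith

end Hankel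

section Counting

open Submodule Module

variable {n p : ℕ}

lemma ptIn_mk (v : Fin (n + 1) → F) (hv : v ≠ 0) (W : Submodule F (Fin (n + 1) → F)) :
    ptIn (Projectivization.mk F v hv) W ↔ v ∈ W := by
  rw [ptIn, Projectivization.submodule_mk, span_singleton_le_iff_mem]

lemma ptIn_iff_rep_mem (P : Pt F n) (W : Submodule F (Fin (n + 1) → F)) :
    ptIn P W ↔ P.rep ∈ W := by
  conv_lhs => rw [← P.mk_rep]
  exact ptIn_mk _ _ _

/-- The value of a word at the point spanned by a vector, extended by `0` at the zero vector. -/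
def val (c : Pt F n → ZMod p) (v : Fin (n + 1) → F) : ZMod p :=
  if h : v ≠ 0 then c (Projectivization.mk F v h) else 0

lemma val_zero (c : Pt F n → ZMod p) : val c 0 = 0 := by simp [val]

lemma val_of_ne_zero (c : Pt F n → ZMod p) {v : Fin (n + 1) → F} (h : v ≠ 0) :
    val c v = c (Projectivization.mk F v h) := by simp [val, h]

lemma val_rep (c : Pt F n → ZMod p) (P : Pt F n) : val c P.rep = c P := by
  rw [val_of_ne_zero c P.rep_nonzero, P.mk_rep]

lemma val_smul (c : Pt F n → ZMod p) {a : F} (ha : a ≠ 0) (v : Fin (n + 1) → F) :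
    val c (a • v) = val c v := by
  by_cases hv : v = 0
  · simp [hv]
  · rw [val_of_ne_zero c hv, val_of_ne_zero c (smul_ne_zero ha hv)]
    congr 1
    exact (Projectivization.mk_eq_mk_iff' F _ _ _ _).mpr ⟨a, rfl⟩

lemma ne_zero_of_val_ne_zero {c : Pt F n → ZMod p} {v : Fin (n + 1) → F} (h : val c v ≠ 0) :
    v ≠ 0 := by
  rintro rfl
  exact h (val_zero c)

lemma finrank_sup_span_singleton {U : Submodule F (Fin (n + 1) → F)} {w : Fin (n + 1) → F}
    (hw : w ∉ U) : finrank F ↥(U ⊔ span F {w}) = finrank F U + 1 := by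
  have h0 : w ≠ 0 := fun h => hw (h ▸ U.zero_mem)
  have h := Submodule.finrank_sup_add_finrank_inf_eq U (span F {w})
  have hd : U ⊓ span F {w} = ⊥ := by
    rw [eq_bot_iff]
    rintro x ⟨hxU, hx⟩
    obtain ⟨a, rfl⟩ := mem_span_singleton.mp hx
    by_cases ha : a = 0
    · simp [ha]
    · exact absurd ((U.smul_mem_iff ha).mp hxU) hw
  rw [hd, finrank_bot, finrank_span_singleton h0] at h
  simpa using h

lemma sup_span_singleton_eq {U W : Submodule F (Fin (n + 1) → F)} {w : Fin (n + 1) → F}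
    (hU : U ≤ W) (hw : w ∈ W) (hwU : w ∉ U) (hd : finrank F W = finrank F U + 1) :
    U ⊔ span F {w} = W := by
  refine Submodule.eq_of_le_of_finrank_eq (sup_le hU ((span_singleton_le_iff_mem _ _).mpr hw)) ?_
  rw [finrank_sup_span_singleton hwU, hd]

lemma exists_sup_span_singleton_eq {U W : Submodule F (Fin (n + 1) → F)}
    (hU : U ≤ W) (hd : finrank F W = finrank F U + 1) :
    ∃ w ∈ W, w ∉ U ∧ U ⊔ span F {w} = W := by
  have hlt : U < W := by
    refine lt_of_le_of_ne hU ?_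
    rintro rfl
    omega
  obtain ⟨w, hw, hwU⟩ := SetLike.exists_of_lt hlt
  exact ⟨w, hw, hwU, sup_span_singleton_eq hU hw hwU hd⟩

variable [Fintype F]

instance : Finite (Pt F n) := by
  unfold Pt
  infer_instance

/-- The number of support vectors of `c` in the affine subspace `w + U`. -/
def cnt (c : Pt F n → ZMod p) (U : Submodule F (Fin (n + 1) → F)) (w : Fin (n + 1) → F) : ℕ :=
  (Finset.univ.filter fun x : Fin (n + 1) → F => x ∈ U ∧ val c (w + x) ≠ 0).card

lemma wtRes_sup (c : Pt F n → ZMod p) {U : Submodule F (Fin (n + 1) → F)} {w : Fin (n + 1) → F}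
    (hw : w ∉ U) : wtRes c (U ⊔ span F {w}) = wtRes c U + cnt c U w := by
  have hne : ∀ x ∈ U, w + x ≠ 0 := fun x hx h => hw (by
    rw [eq_neg_of_add_eq_zero_left h]; exact U.neg_mem hx)
  have hsplit : ptsIn (U ⊔ span F {w}) ∩ supp c
      = (ptsIn U ∩ supp c) ∪ ((ptsIn (U ⊔ span F {w}) ∩ supp c) \ ptsIn U) := by
    ext P
    have : P ∈ ptsIn U → P ∈ ptsIn (U ⊔ span F {w}) := fun h => h.trans (le_sup_left (b := span F {w}))
    simp only [Set.mem_inter_iff, Set.mem_union, Set.mem_sdiff]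
    tauto
  have hcnt : cnt c U w = ((ptsIn (U ⊔ span F {w}) ∩ supp c) \ ptsIn U).ncard := by
    rw [cnt, ← Set.ncard_coe_finset]
    refine Set.ncard_congr (fun x hx => Projectivization.mk F (w + x) (hne x (by
      simp at hx; exact hx.1))) ?_ ?_ ?_
    · intro x hx
      simp only [Finset.coe_filter, Finset.mem_univ, true_and, Set.mem_ofPred_eq] at hx
      refine ⟨⟨?_, ?_⟩, ?_⟩
      · exact (ptIn_mk _ _ _).mpr
          (add_mem (mem_sup_right (mem_span_singleton_self w)) (mem_sup_left hx.1))
      · have := hx.2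
        rwa [val_of_ne_zero c (hne x hx.1)] at this
      · intro h
        have h := (ptIn_mk _ _ _).mp h
        exact hw ((U.add_mem_iff_left hx.1).mp h)
    · intro x y hx hy h
      simp only [Finset.coe_filter, Finset.mem_univ, true_and, Set.mem_ofPred_eq] at hx hy
      obtain ⟨a, ha⟩ := (Projectivization.mk_eq_mk_iff' F _ _ _ _).mp h
      have h1 : (a - 1) • w ∈ U := by
        have : (a - 1) • w = x - a • y := by
          rw [sub_smul, one_smul, sub_eq_sub_iff_add_eq_add, ← smul_add, ha, add_comm w x]
        rw [this]
        exact sub_mem hx.1 (U.smul_mem _ hy.1)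
      have h2 : a = 1 := by
        by_contra hne1
        exact hw ((U.smul_mem_iff (sub_ne_zero.mpr hne1)).mp h1)
      rw [h2, one_smul] at ha
      exact (add_left_cancel ha).symm
    · rintro P ⟨⟨hP, hPc⟩, hPU⟩
      have hP := (ptIn_iff_rep_mem _ _).mp hP
      have hPU : P.rep ∉ U := fun h => hPU ((ptIn_iff_rep_mem _ _).mpr h)
      obtain ⟨y, hy, z, hz, hyz⟩ := mem_sup.mp hP
      obtain ⟨a, rfl⟩ := mem_span_singleton.mp hz
      have ha : a ≠ 0 := by
        rintro rfl
        apply hPU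
        rw [← hyz]
        simpa using hy
      have hrep : w + a⁻¹ • y = a⁻¹ • P.rep := by
        rw [← hyz, smul_add, smul_smul, inv_mul_cancel₀ ha, one_smul, add_comm w]
      refine ⟨a⁻¹ • y, ?_, ?_⟩
      · simp only [Finset.coe_filter, Finset.mem_univ, true_and, Set.mem_ofPred_eq]
        refine ⟨U.smul_mem _ hy, ?_⟩
        rw [hrep, val_smul c (inv_ne_zero ha), val_rep]
        exact hPc
      · conv_rhs => rw [← P.mk_rep]
        exact (Projectivization.mk_eq_mk_iff' F _ _ _ _).mpr ⟨a⁻¹, hrep.symm⟩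
  rw [wtRes, hsplit, Set.ncard_union_eq, hcnt, wtRes]
  exact Set.disjoint_left.mpr fun P h h' => h'.2 h.1

lemma wtRes_bot (c : Pt F n → ZMod p) : wtRes c ⊥ = 0 := by
  rw [wtRes, Set.ncard_eq_zero, Set.eq_empty_iff_forall_notMem]
  rintro P ⟨hP, -⟩
  exact P.rep_nonzero ((mem_bot F).mp ((ptIn_iff_rep_mem _ _).mp hP))

lemma cnt_bot (c : Pt F n → ZMod p) (w : Fin (n + 1) → F) :
    cnt c ⊥ w = if val c w ≠ 0 then 1 else 0 := by
  have : (Finset.univ.filter fun x : Fin (n + 1) → F =>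
      x ∈ (⊥ : Submodule F (Fin (n + 1) → F)) ∧ val c (w + x) ≠ 0)
      = if val c w ≠ 0 then {0} else ∅ := by
    ext x
    split_ifs with h <;> simp only [mem_bot, Finset.mem_filter, Finset.mem_univ, true_and,
      Finset.mem_singleton, Finset.notMem_empty, iff_false, not_and, not_not]
    · refine ⟨fun h => h.1, ?_⟩
      rintro rfl
      exact ⟨rfl, by rwa [add_zero]⟩
    · rintro rfl
      rw [add_zero]
      exact not_not.mp h
  rw [cnt, this]
  split_ifs <;> rfl

lemma wtRes_span_singleton (c : Pt F n → ZMod p) {w : Fin (n + 1) → F} (hw : w ≠ 0) :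
    wtRes c (span F {w}) = if val c w ≠ 0 then 1 else 0 := by
  rw [← cnt_bot, ← bot_sup_eq (span F {w}), wtRes_sup c (by simpa using hw), wtRes_bot, zero_add]

lemma cnt_le_card (c : Pt F n → ZMod p) (U : Submodule F (Fin (n + 1) → F))
    (w : Fin (n + 1) → F) : cnt c U w ≤ Fintype.card F ^ finrank F U := by
  rw [← Module.card_eq_pow_finrank, Fintype.card_subtype]
  exact Finset.card_le_card fun x hx => by
    simp only [Finset.mem_filter, Finset.mem_univ, true_and] at hx ⊢
    exact hx.1

lemma cnt_add (c : Pt F n → ZMod p) {U : Submodule F (Fin (n + 1) → F)} (w : Fin (n + 1) → F)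
    {u : Fin (n + 1) → F} (hu : u ∈ U) : cnt c U (w + u) = cnt c U w := by
  refine Finset.card_bij' (fun x _ => u + x) (fun x _ => x - u) ?_ ?_ ?_ ?_
  · intro x hx
    simp only [Finset.mem_filter, Finset.mem_univ, true_and] at hx ⊢
    exact ⟨add_mem hu hx.1, by rw [← add_assoc]; exact hx.2⟩
  · intro x hx
    simp only [Finset.mem_filter, Finset.mem_univ, true_and] at hx ⊢
    exact ⟨sub_mem hx.1 hu, by rw [add_assoc, add_sub_cancel]; exact hx.2⟩
  · intro x _; simp
  · intro x _; simp

lemma cnt_sup (c : Pt F n → ZMod p) {U : Submodule F (Fin (n + 1) → F)} {v : Fin (n + 1) → F}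
    (hv : v ∉ U) (w : Fin (n + 1) → F) :
    cnt c (U ⊔ span F {v}) w = ∑ y : F, cnt c U (w + y • v) := by
  simp only [cnt]
  rw [← Finset.card_sigma]
  symm
  refine Finset.card_bij (fun s _ => s.1 • v + s.2) ?_ ?_ ?_
  · rintro ⟨y, x⟩ h
    simp only [Finset.mem_sigma, Finset.mem_filter, Finset.mem_univ, true_and] at h ⊢
    refine ⟨add_mem (mem_sup_right (mem_span_singleton.mpr ⟨y, rfl⟩)) (mem_sup_left h.1), ?_⟩
    rw [← add_assoc]; exact h.2
  · rintro ⟨y, x⟩ h ⟨y', x'⟩ h' e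
    simp only [Finset.mem_sigma, Finset.mem_filter, Finset.mem_univ, true_and] at h h' e
    have h1 : (y - y') • v ∈ U := by
      have : (y - y') • v = x' - x := by
        rw [sub_smul, sub_eq_sub_iff_add_eq_add, e, add_comm _ x']
      rw [this]; exact sub_mem h'.1 h.1
    have h2 : y = y' := by
      by_contra hne
      exact hv ((U.smul_mem_iff (sub_ne_zero.mpr hne)).mp h1)
    subst h2
    rw [add_left_cancel e]
  · intro x hx
    simp only [Finset.mem_filter, Finset.mem_univ, true_and] at hx
    obtain ⟨z, hz, t, ht, rfl⟩ := mem_sup.mp hx.1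
    obtain ⟨a, rfl⟩ := mem_span_singleton.mp ht
    refine ⟨⟨a, z⟩, ?_, add_comm _ _⟩
    simp only [Finset.mem_sigma, Finset.mem_filter, Finset.mem_univ, true_and]
    exact ⟨hz, by rw [add_assoc, add_comm (a • v)]; exact hx.2⟩

/-- The number of vectors spanning a point of the support of `c`. -/
def suppCard (c : Pt F n → ZMod p) : ℕ :=
  (Finset.univ.filter fun v : Fin (n + 1) → F => val c v ≠ 0).card

lemma sum_cnt (c : Pt F n → ZMod p) (U : Submodule F (Fin (n + 1) → F)) :
    ∑ w : Fin (n + 1) → F, cnt c U w = Fintype.card F ^ finrank F U * suppCard c := by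
  simp only [cnt, Finset.card_filter]
  rw [Finset.sum_comm]
  have : ∀ x : Fin (n + 1) → F, ∑ w : Fin (n + 1) → F,
      (if x ∈ U ∧ val c (w + x) ≠ 0 then 1 else 0) = if x ∈ U then suppCard c else 0 := by
    intro x
    by_cases hx : x ∈ U
    · simp only [hx, true_and, if_true, suppCard, Finset.card_filter]
      exact Equiv.sum_comp (Equiv.addRight x) fun w => if val c w ≠ 0 then 1 else 0
    · simp [hx]
  simp only [this]
  rw [← Finset.sum_filter, Finset.sum_const, smul_eq_mul, ← Module.card_eq_pow_finrank,
    Fintype.card_subtype]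

lemma mul_card_le_of_le_cnt (c : Pt F n → ZMod p) (U : Submodule F (Fin (n + 1) → F))
    (X : Finset (Fin (n + 1) → F)) (A : ℕ) (h : ∀ w ∈ X, A ≤ cnt c U w) :
    A * X.card ≤ Fintype.card F ^ finrank F U * suppCard c := by
  rw [← sum_cnt, mul_comm, ← smul_eq_mul, ← Finset.sum_const]
  exact (Finset.sum_le_sum h).trans
    (Finset.sum_le_sum_of_subset (Finset.subset_univ X))

lemma suppCard_eq (c : Pt F n → ZMod p) :
    suppCard c = (Fintype.card F - 1) * wt c := by
  have hfin : (supp c).Finite := Set.toFinite _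
  rw [wt, Set.ncard_eq_toFinset_card _ hfin, ← Fintype.card_units, ← Finset.card_univ,
    mul_comm, ← Finset.card_product, suppCard]
  symm
  refine Finset.card_bij (fun s _ => (s.2 : F) • s.1.rep) ?_ ?_ ?_
  · rintro ⟨P, a⟩ h
    simp only [Finset.mem_product, Set.Finite.mem_toFinset, Finset.mem_univ, and_true,
      Finset.mem_filter, true_and] at h ⊢
    rw [val_smul c a.ne_zero, val_rep]
    exact h
  · rintro ⟨P, a⟩ h ⟨P', a'⟩ h' e
    simp only at e
    have hP : P = P' := by
      rw [← P.mk_rep, ← P'.mk_rep, Projectivization.mk_eq_mk_iff']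
      exact ⟨(a⁻¹ : Fˣ) * a', by rw [mul_smul, ← e, smul_smul]; simp⟩
    subst hP
    have := smul_left_injective F P.rep_nonzero e
    rw [Units.ext this]
  · intro v hv
    simp only [Finset.mem_filter, Finset.mem_univ, true_and] at hv
    have h0 := ne_zero_of_val_ne_zero hv
    obtain ⟨a, ha⟩ := Projectivization.exists_smul_eq_mk_rep F v h0
    refine ⟨(Projectivization.mk F v h0, a⁻¹), ?_, ?_⟩
    · simp only [Finset.mem_product, Set.Finite.mem_toFinset, Finset.mem_univ, and_true]
      rwa [val_of_ne_zero c h0] at hv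
    · simp only [← ha, Units.smul_def, smul_smul]
      simp

end Counting

section CodeWords

open Submodule Module

variable {n p : ℕ}

lemma val_add (c d : Pt F n → ZMod p) (v : Fin (n + 1) → F) :
    val (c + d) v = val c v + val d v := by
  by_cases h : v = 0
  · simp [h, val_zero]
  · simp [val_of_ne_zero _ h]

lemma val_const_smul (a : ZMod p) (c : Pt F n → ZMod p) (v : Fin (n + 1) → F) :
    val (a • c) v = a * val c v := by
  by_cases h : v = 0
  · simp [h, val_zero]
  · simp [val_of_ne_zero _ h]

lemma val_zero_word (v : Fin (n + 1) → F) : val (0 : Pt F n → ZMod p) v = 0 := by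
  by_cases h : v = 0
  · simp [h, val_zero]
  · simp [val_of_ne_zero _ h]

lemma val_incVec (W : Submodule F (Fin (n + 1) → F)) {v : Fin (n + 1) → F} (h : v ≠ 0) :
    val (incVec p W) v = if v ∈ W then 1 else 0 := by
  rw [val_of_ne_zero _ h]
  simp only [incVec, ptIn_mk]

lemma exists_ker_eq_of_finrank {W : Submodule F (Fin (n + 1) → F)} (hW : finrank F W = n) :
    ∃ φ : (Fin (n + 1) → F) →ₗ[F] F, φ ≠ 0 ∧ LinearMap.ker φ = W := by
  have hlt : W < ⊤ := by
    refine lt_of_le_of_ne le_top ?_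
    rintro rfl
    simp at hW
  obtain ⟨φ, hφ, hle⟩ := W.exists_le_ker_of_lt_top hlt
  refine ⟨φ, hφ, (Submodule.eq_of_le_of_finrank_eq hle ?_).symm⟩
  have h1 := φ.finrank_range_add_finrank_ker
  have h2 : finrank F (LinearMap.range φ) = 1 := by
    rw [LinearMap.range_eq_top.mpr (LinearMap.surjective hφ)]
    simp
  simp only [h2, finrank_fin_fun] at h1
  omega

/-- To prove a linear property of code words it suffices to check it on hyperplanes, given as
kernels of linear forms. -/
lemma code_induction {Q : (Pt F n → ZMod p) → Prop} (h0 : Q 0)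
    (hadd : ∀ c d, Q c → Q d → Q (c + d)) (hsmul : ∀ (a : ZMod p) c, Q c → Q (a • c))
    (hgen : ∀ φ : (Fin (n + 1) → F) →ₗ[F] F, φ ≠ 0 → Q (incVec p (LinearMap.ker φ)))
    {c : Pt F n → ZMod p} (hc : c ∈ code F p n) : Q c := by
  refine Submodule.span_induction ?_ h0 (fun x y _ _ => hadd x y) (fun a x _ => hsmul a x) hc
  rintro _ ⟨W, hW, rfl⟩
  obtain ⟨φ, hφ, rfl⟩ := exists_ker_eq_of_finrank hW
  exact hgen φ hφ

lemma notMem_span_singleton_add {u v : Fin (n + 1) → F} (hv : v ∉ span F {u}) (x : F) :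
    v + x • u ≠ 0 := fun h => hv (by
  rw [eq_neg_of_add_eq_zero_left h]
  exact neg_mem (smul_mem _ _ (mem_span_singleton_self u)))

lemma castHom_ne_zero_iff [Fact p.Prime] [CharP F p] (a : ZMod p) :
    ZMod.castHom (dvd_refl p) F a ≠ 0 ↔ a ≠ 0 :=
  map_ne_zero_iff _ (RingHom.injective _)

lemma exists_line_eq {L : Submodule F (Fin (n + 1) → F)} (hL : IsLine L)
    {u : Fin (n + 1) → F} (hu : u ≠ 0) (huL : u ∈ L) :
    ∃ v ∈ L, v ∉ span F {u} ∧ span F {u} ⊔ span F {v} = L :=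
  exists_sup_span_singleton_eq ((span_singleton_le_iff_mem _ _).mpr huL)
    (by rw [hL, finrank_span_singleton hu])

lemma exists_plane_eq {L W : Submodule F (Fin (n + 1) → F)} (hL : IsLine L) (hW : IsPlane W)
    (h : L ≤ W) : ∃ w ∈ W, w ∉ L ∧ L ⊔ span F {w} = W :=
  exists_sup_span_singleton_eq h (by rw [hL, hW])

lemma isLine_span_pair {u v : Fin (n + 1) → F} (hu : u ≠ 0) (hv : v ∉ span F {u}) :
    IsLine (span F {u} ⊔ span F {v}) := by
  rw [IsLine, finrank_sup_span_singleton hv, finrank_span_singleton hu]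

lemma isPlane_sup {L : Submodule F (Fin (n + 1) → F)} (hL : IsLine L) {w : Fin (n + 1) → F}
    (hw : w ∉ L) : IsPlane (L ⊔ span F {w}) := by
  rw [IsPlane, finrank_sup_span_singleton hw, hL]

variable [Fintype F]

lemma natCast_card_eq_zero [CharP F p] : ((Fintype.card F : ℕ) : ZMod p) = 0 := by
  rw [ZMod.natCast_eq_zero_iff, ← CharP.cast_eq_zero_iff F p]
  exact FiniteField.cast_card_eq_zero F

/-- The values of a code word sum to the same constant on all lines. -/
lemma exists_line_sum [CharP F p] {c : Pt F n → ZMod p} (hc : c ∈ code F p n) :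
    ∃ k : ZMod p, ∀ u v : Fin (n + 1) → F, u ≠ 0 → v ∉ span F {u} →
      val c u + ∑ x : F, val c (v + x • u) = k := by
  refine code_induction (Q := fun c => ∃ k : ZMod p, ∀ u v : Fin (n + 1) → F, u ≠ 0 →
    v ∉ span F {u} → val c u + ∑ x : F, val c (v + x • u) = k) ?_ ?_ ?_ ?_ hc
  · exact ⟨0, fun u v _ _ => by simp [val_zero_word]⟩
  · rintro c d ⟨k, hk⟩ ⟨l, hl⟩
    refine ⟨k + l, fun u v hu hv => ?_⟩
    rw [← hk u v hu hv, ← hl u v hu hv]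
    simp only [val_add, Finset.sum_add_distrib]
    ring
  · rintro a c ⟨k, hk⟩
    refine ⟨a * k, fun u v hu hv => ?_⟩
    rw [← hk u v hu hv]
    simp only [val_const_smul, ← Finset.mul_sum]
    ring
  · intro φ hφ
    refine ⟨1, fun u v hu hv => ?_⟩
    have hx : ∀ x : F, val (incVec p (LinearMap.ker φ)) (v + x • u)
        = if φ v + x * φ u = 0 then 1 else 0 := fun x => by
      rw [val_incVec _ (notMem_span_singleton_add hv x)]
      simp [LinearMap.mem_ker]
    simp only [hx, val_incVec _ hu, LinearMap.mem_ker]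
    by_cases h : φ u = 0
    · by_cases h' : φ v = 0 <;> simp [h, h', natCast_card_eq_zero]
    · have : ∀ x : F, (φ v + x * φ u = 0) ↔ x = - φ v / φ u := fun x => by
        rw [eq_div_iff h, add_comm, add_eq_zero_iff_eq_neg]
      simp [this, h]

/-- The values of a code word on the affine plane `v + ⟨u, w⟩` are given by a polynomial of total
degree less than `q`. -/
lemma exists_polynomial_eq_val [CharP F p] {c : Pt F n → ZMod p} (hc : c ∈ code F p n)
    (u v w : Fin (n + 1) → F) :
    ∃ a : ℕ → Polynomial F, (∀ l, (a l).natDegree ≤ Fintype.card F - 1 - l) ∧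
      ∀ x y : F, v + y • w + x • u ≠ 0 →
        ZMod.castHom (dvd_refl p) F (val c (v + y • w + x • u))
          = ∑ l ∈ Finset.range (Fintype.card F), (a l).eval y * x ^ l := by
  refine code_induction (Q := fun c => ∃ a : ℕ → Polynomial F,
    (∀ l, (a l).natDegree ≤ Fintype.card F - 1 - l) ∧
      ∀ x y : F, v + y • w + x • u ≠ 0 →
        ZMod.castHom (dvd_refl p) F (val c (v + y • w + x • u))
          = ∑ l ∈ Finset.range (Fintype.card F), (a l).eval y * x ^ l) ?_ ?_ ?_ ?_ hc
  · exact ⟨0, by simp, by simp [val_zero_word]⟩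
  · rintro c d ⟨a, ha, ha'⟩ ⟨b, hb, hb'⟩
    refine ⟨a + b, fun l => ?_, fun x y h => ?_⟩
    · exact (Polynomial.natDegree_add_le _ _).trans (max_le (ha l) (hb l))
    · rw [val_add, map_add, ha' x y h, hb' x y h, ← Finset.sum_add_distrib]
      refine Finset.sum_congr rfl fun l _ => ?_
      simp [add_mul]
  · rintro t c ⟨a, ha, ha'⟩
    refine ⟨fun l => Polynomial.C (ZMod.castHom (dvd_refl p) F t) * a l, fun l => ?_,
      fun x y h => ?_⟩
    · exact (Polynomial.natDegree_C_mul_le _ _).trans (ha l)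
    · rw [val_const_smul, map_mul, ha' x y h, Finset.mul_sum]
      refine Finset.sum_congr rfl fun l _ => ?_
      simp [mul_assoc]
  · intro φ hφ
    have hq : 0 < Fintype.card F - 1 := by
      have := Fintype.one_lt_card (α := F)
      omega
    let b : ℕ → Polynomial F := fun l =>
      Polynomial.C (φ u ^ l * ((Fintype.card F - 1).choose l : ℕ)) *
        (Polynomial.C (φ w) * Polynomial.X + Polynomial.C (φ v)) ^ (Fintype.card F - 1 - l)
    have hb : ∀ l, (b l).natDegree ≤ Fintype.card F - 1 - l := fun l => by
      refine (Polynomial.natDegree_C_mul_le _ _).trans ?_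
      refine (Polynomial.natDegree_pow_le_of_le _ Polynomial.natDegree_linear_le).trans ?_
      simp
    have hbs : ∀ x y : F, ∑ l ∈ Finset.range (Fintype.card F), (b l).eval y * x ^ l
        = (φ v + y * φ w + x * φ u) ^ (Fintype.card F - 1) := fun x y => by
      rw [add_comm, add_pow, Nat.sub_add_cancel (Fintype.card_pos (α := F))]
      refine Finset.sum_congr rfl fun l _ => ?_
      simp only [b, Polynomial.eval_mul, Polynomial.eval_C, Polynomial.eval_pow,
        Polynomial.eval_add, Polynomial.eval_X]
      rw [mul_pow]
      ring
    refine ⟨fun l => (if l = 0 then 1 else 0) - b l, fun l => ?_, fun x y h => ?_⟩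
    · refine (Polynomial.natDegree_sub_le _ _).trans (max_le ?_ (hb l))
      split_ifs <;> simp
    · have h1 : ∑ l ∈ Finset.range (Fintype.card F),
          ((if l = 0 then 1 else 0) - b l : Polynomial F).eval y * x ^ l
          = 1 - (φ v + y * φ w + x * φ u) ^ (Fintype.card F - 1) := by
        rw [← hbs x y]
        simp only [Polynomial.eval_sub, sub_mul, Finset.sum_sub_distrib]
        congr 1
        have : ∀ l, Polynomial.eval y (if l = 0 then (1 : Polynomial F) else 0) * x ^ l
            = if l = 0 then 1 else 0 := fun l => by
          split_ifs with hl <;> simp [hl]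
        simp only [this]
        simp [Fintype.card_pos]
      rw [h1, val_incVec _ h]
      have h2 : (v + y • w + x • u ∈ LinearMap.ker φ) ↔ φ v + y * φ w + x * φ u = 0 := by
        simp [LinearMap.mem_ker]
      by_cases h3 : φ v + y * φ w + x * φ u = 0
      · simp [h2, h3, hq.ne']
      · simp [h2, h3, FiniteField.pow_card_sub_one_eq_one _ h3]

lemma cnt_span_singleton (c : Pt F n → ZMod p) {u : Fin (n + 1) → F} (hu : u ≠ 0)
    (v : Fin (n + 1) → F) :
    cnt c (span F {u}) v = (Finset.univ.filter fun x : F => val c (v + x • u) ≠ 0).card := by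
  rw [← bot_sup_eq (span F {u}), cnt_sup c (by simpa using hu), Finset.card_filter]
  simp only [cnt_bot]

lemma mul_le_sum_cnt [Fact p.Prime] [CharP F p] {c : Pt F n → ZMod p} (hc : c ∈ code F p n)
    {u v w : Fin (n + 1) → F} (hu : u ≠ 0) (hv : v ∉ span F {u} ⊔ span F {w}) :
    cnt c (span F {u}) v * (Fintype.card F + 1 - cnt c (span F {u}) v)
      ≤ ∑ y : F, cnt c (span F {u}) (v + y • w) := by
  obtain ⟨a, ha, ha'⟩ := exists_polynomial_eq_val hc u v w
  have hne : ∀ x y : F, v + y • w + x • u ≠ 0 := fun x y h => hv (by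
    rw [add_assoc] at h
    rw [eq_neg_of_add_eq_zero_left h]
    exact neg_mem (add_mem (mem_sup_right (smul_mem _ _ (mem_span_singleton_self w)))
      (mem_sup_left (smul_mem _ _ (mem_span_singleton_self u)))))
  have := mul_le_card_ne_zero a ha (fun y => cnt c (span F {u}) (v + y • w)) (fun y => by
    rw [cnt_span_singleton c hu]
    congr 1
    ext x
    simp only [Finset.mem_filter, Finset.mem_univ, true_and]
    rw [← ha' x y (hne x y), castHom_ne_zero_iff]) 0
  simpa using this

lemma wtRes_span_pair (c : Pt F n → ZMod p) {u v : Fin (n + 1) → F} (hu : u ≠ 0)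
    (hv : v ∉ span F {u}) :
    wtRes c (span F {u} ⊔ span F {v})
      = (if val c u ≠ 0 then 1 else 0) + cnt c (span F {u}) v := by
  rw [wtRes_sup c hv, wtRes_span_singleton c hu]

lemma wtRes_line_le (c : Pt F n → ZMod p) {L : Submodule F (Fin (n + 1) → F)} (hL : IsLine L)
    {u : Fin (n + 1) → F} (hu : u ≠ 0) (huL : u ∈ L) (hc : val c u = 0) :
    wtRes c L ≤ Fintype.card F := by
  obtain ⟨v, hv, hvu, rfl⟩ := exists_line_eq hL hu huL
  rw [wtRes_span_pair c hu hvu]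
  have := cnt_le_card c (span F {u}) v
  rw [finrank_span_singleton hu, pow_one] at this
  simpa [hc] using this

/-- A line with a point outside the support forces many support points in every plane on it. -/
lemma wtRes_mul_le_cnt [Fact p.Prime] [CharP F p] {c : Pt F n → ZMod p} (hc : c ∈ code F p n)
    {L : Submodule F (Fin (n + 1) → F)} (hL : IsLine L) {u w : Fin (n + 1) → F} (hu : u ≠ 0)
    (huL : u ∈ L) (hcu : val c u = 0) (hw : w ∉ L) :
    wtRes c L * (Fintype.card F - wtRes c L) ≤ cnt c L w := by
  have hle := wtRes_line_le c hL hu huL hcu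
  obtain ⟨v, hv, hvu, rfl⟩ := exists_line_eq hL hu huL
  have hs : wtRes c (span F {u} ⊔ span F {v}) = cnt c (span F {u}) v := by
    rw [wtRes_span_pair c hu hvu]; simp [hcu]
  have hwu : w ∉ span F {u} := fun h => hw (mem_sup_left h)
  have hvuw : v ∉ span F {u} ⊔ span F {w} := by
    intro h
    obtain ⟨y, hy, z, hz, hyz⟩ := mem_sup.mp h
    obtain ⟨b, rfl⟩ := mem_span_singleton.mp hz
    by_cases hb : b = 0
    · rw [hb, zero_smul, add_zero] at hyz
      exact hvu (hyz ▸ hy)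
    · refine hw ?_
      have : b • w ∈ span F {u} ⊔ span F {v} := by
        rw [← eq_sub_iff_add_eq'] at hyz
        rw [hyz]
        exact sub_mem (mem_sup_right (mem_span_singleton_self v)) (mem_sup_left hy)
      exact (smul_mem_iff _ hb).mp this
  have h1 := wtRes_sup c hw
  have h2 : span F {u} ⊔ span F {v} ⊔ span F {w} = span F {u} ⊔ span F {w} ⊔ span F {v} :=
    sup_right_comm _ _ _
  rw [h2, wtRes_sup c hvuw, cnt_sup c hwu, wtRes_span_pair c hu hwu, hs] at h1
  have h3 := mul_le_sum_cnt hc hu hvuw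
  rw [hs] at hle ⊢
  obtain ⟨k, hk⟩ := Nat.exists_eq_add_of_le hle
  have e1 : Fintype.card F + 1 - cnt c (span F {u}) v = k + 1 := by omega
  have e2 : Fintype.card F - cnt c (span F {u}) v = k := by omega
  rw [e1] at h3
  rw [e2]
  simp only [hcu, ne_eq, not_true_eq_false, if_false] at h1
  nlinarith

lemma card_notMem (U : Submodule F (Fin (n + 1) → F)) :
    (Finset.univ.filter fun w : Fin (n + 1) → F => w ∉ U).card
      = Fintype.card F ^ (n + 1) - Fintype.card F ^ finrank F U := by
  have h := Finset.card_filter_add_card_filter_not (s := (Finset.univ : Finset (Fin (n + 1) → F)))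
    (fun w => w ∈ U)
  have h2 : (Finset.univ.filter fun w : Fin (n + 1) → F => w ∈ U).card
      = Fintype.card F ^ finrank F U := by
    rw [← Module.card_eq_pow_finrank, Fintype.card_subtype]
  rw [h2, Finset.card_univ, Fintype.card_fun, Fintype.card_fin] at h
  omega

lemma wtRes_line_of_forall (c : Pt F n → ZMod p) {L : Submodule F (Fin (n + 1) → F)}
    (hL : IsLine L) (h : ∀ u ∈ L, u ≠ 0 → val c u ≠ 0) : wtRes c L = Fintype.card F + 1 := by
  have : ∃ u ∈ L, u ≠ 0 := by
    by_contra! h0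
    have : L = ⊥ := (Submodule.eq_bot_iff _).mpr h0
    rw [IsLine, this, finrank_bot] at hL
    omega
  obtain ⟨u, huL, hu⟩ := this
  obtain ⟨v, hv, hvu, rfl⟩ := exists_line_eq hL hu huL
  rw [wtRes_span_pair c hu hvu, cnt_span_singleton c hu]
  have : (Finset.univ.filter fun x : F => val c (v + x • u) ≠ 0) = Finset.univ := by
    refine Finset.filter_true_of_mem fun x _ => h _ ?_ (notMem_span_singleton_add hvu x)
    exact add_mem hv (smul_mem _ _ huL)
  rw [this, Finset.card_univ, if_pos (h u huL hu), add_comm]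

/-- Lines meet the support in few or in almost all of their points. -/
lemma wtRes_line_dichotomy [Fact p.Prime] [CharP F p] (hn : 3 ≤ n) (hq : 29 ≤ Fintype.card F)
    {c : Pt F n → ZMod p} (hc : c ∈ code F p n)
    (hD : suppCard c ≤ (Fintype.card F - 1) * (4 * (Fintype.card F - 4))
      * Fintype.card F ^ (n - 2))
    {L : Submodule F (Fin (n + 1) → F)} (hL : IsLine L) :
    wtRes c L ≤ 3 ∨ Fintype.card F - 3 ≤ wtRes c L := by
  by_contra! hs
  by_cases h : ∀ u ∈ L, u ≠ 0 → val c u ≠ 0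
  · have := wtRes_line_of_forall c hL h
    omega
  push Not at h
  obtain ⟨u, huL, hu, hcu⟩ := h
  have h1 := mul_card_le_of_le_cnt c L (Finset.univ.filter fun w => w ∉ L)
    (4 * (Fintype.card F - 4)) (fun w hw => by
      refine le_trans ?_ (wtRes_mul_le_cnt hc hL hu huL hcu (Finset.mem_filter.mp hw).2)
      obtain ⟨a, ha⟩ := Nat.exists_eq_add_of_le (show 4 ≤ wtRes c L by omega)
      obtain ⟨b, hb⟩ := Nat.exists_eq_add_of_le (show wtRes c L + 4 ≤ Fintype.card F by omega)
      have e1 : Fintype.card F - 4 = a + b + 4 := by omega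
      have e2 : Fintype.card F - wtRes c L = 4 + b := by omega
      rw [e1, e2, ha]
      nlinarith [Nat.zero_le (a * b)])
  rw [card_notMem, hL] at h1
  obtain ⟨m, rfl⟩ := Nat.exists_eq_add_of_le hn
  generalize Fintype.card F = q at *
  obtain ⟨r, rfl⟩ := Nat.exists_eq_add_of_le (show 5 ≤ q by omega)
  have e1 : 5 + r - 1 = r + 4 := by omega
  have e2 : 5 + r - 4 = r + 1 := by omega
  have e3 : 3 + m - 2 = m + 1 := by omega
  rw [e1, e2, e3] at hD
  rw [e2] at h1
  have e4 : (5 + r) ^ (3 + m + 1) - (5 + r) ^ 2 = (5 + r) ^ 2 * ((5 + r) ^ (m + 2) - 1) := by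
    rw [Nat.mul_sub, ← pow_add]
    congr 2
    · omega
    · simp
  rw [e4] at h1
  have h2 : 4 * (r + 1) * ((5 + r) ^ (m + 2) - 1) ≤ suppCard c := by
    have hpos : 0 < (5 + r) ^ 2 := by positivity
    exact Nat.le_of_mul_le_mul_left (by nlinarith) hpos
  have h3 : (5 + r) ^ (m + 2) = (5 + r) ^ (m + 1) * (5 + r) := pow_succ _ _
  have h4 : 1 < (5 + r) ^ (m + 1) := Nat.one_lt_pow (by omega) (by omega)
  have h5 : (r + 4) * (4 * (r + 1)) * (5 + r) ^ (m + 1) < 4 * (r + 1) * ((5 + r) ^ (m + 2) - 1) := by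
    have : (r + 4) * (5 + r) ^ (m + 1) < (5 + r) ^ (m + 2) - 1 := by
      rw [h3]
      have : (5 + r) ^ (m + 1) * (5 + r) = (r + 4) * (5 + r) ^ (m + 1) + (5 + r) ^ (m + 1) := by
        ring
      omega
    calc (r + 4) * (4 * (r + 1)) * (5 + r) ^ (m + 1)
        = 4 * (r + 1) * ((r + 4) * (5 + r) ^ (m + 1)) := by ring
      _ < _ := Nat.mul_lt_mul_of_pos_left this (by positivity)
  omega

/-- A plane through a point all of whose lines are short has few support points. -/
lemma wtRes_plane_le (c : Pt F n → ZMod p) {W : Submodule F (Fin (n + 1) → F)} (hW : IsPlane W)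
    {u : Fin (n + 1) → F} (hu : u ≠ 0) (huW : u ∈ W)
    (h : ∀ L, IsLine L → u ∈ L → L ≤ W → wtRes c L ≤ 3) :
    wtRes c W ≤ (if val c u ≠ 0 then 1 else 0)
      + (Fintype.card F + 1) * (3 - if val c u ≠ 0 then 1 else 0) := by
  have hle : span F {u} ≤ W := (span_singleton_le_iff_mem _ _).mpr huW
  obtain ⟨w, hw, hwu⟩ : ∃ w ∈ W, w ∉ span F {u} := by
    by_contra! h0
    have h1 := Submodule.finrank_mono (show W ≤ span F {u} from h0)
    rw [finrank_span_singleton hu, hW] at h1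
    omega
  have hL := isLine_span_pair hu hwu
  have hLW : span F {u} ⊔ span F {w} ≤ W := sup_le hle ((span_singleton_le_iff_mem _ _).mpr hw)
  obtain ⟨v, hv, hvL, rfl⟩ := exists_plane_eq hL hW hLW
  rw [wtRes_sup c hvL, cnt_sup c hwu]
  have hN : ∀ r ∈ span F {u} ⊔ span F {w} ⊔ span F {v}, r ∉ span F {u} →
      cnt c (span F {u}) r ≤ 3 - if val c u ≠ 0 then 1 else 0 := by
    intro r hr hru
    have h1 := h _ (isLine_span_pair hu hru) (mem_sup_left (mem_span_singleton_self u))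
      (sup_le hle ((span_singleton_le_iff_mem _ _).mpr hr))
    rw [wtRes_span_pair c hu hru] at h1
    omega
  rw [wtRes_span_pair c hu hwu]
  have h1 := hN w hw hwu
  have h2 : ∑ y : F, cnt c (span F {u}) (v + y • w)
      ≤ ∑ _y : F, (3 - if val c u ≠ 0 then 1 else 0) := by
    refine Finset.sum_le_sum fun y _ => hN _ (add_mem hv (smul_mem _ _ hw)) fun h' => hvL ?_
    have := sub_mem (mem_sup_left h' : v + y • w ∈ span F {u} ⊔ span F {w})
      (mem_sup_right (smul_mem _ y (mem_span_singleton_self w)))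
    rwa [add_sub_cancel_right] at this
  rw [Finset.sum_const, Finset.card_univ, smul_eq_mul] at h2
  nlinarith

end CodeWords

section Planes

open Submodule Module

variable {n p : ℕ}

lemma notMem_sup_span_comm {U : Submodule F (Fin (n + 1) → F)} {v w : Fin (n + 1) → F}
    (hv : v ∉ U) (hw : w ∉ U ⊔ span F {v}) : v ∉ U ⊔ span F {w} := by
  intro h
  obtain ⟨y, hy, z, hz, hyz⟩ := mem_sup.mp h
  obtain ⟨b, rfl⟩ := mem_span_singleton.mp hz
  by_cases hb : b = 0
  · rw [hb, zero_smul, add_zero] at hyz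
    exact hv (hyz ▸ hy)
  · refine hw ((smul_mem_iff _ hb).mp ?_)
    rw [← eq_sub_iff_add_eq'] at hyz
    rw [hyz]
    exact sub_mem (mem_sup_right (mem_span_singleton_self v)) (mem_sup_left hy)

lemma line_eq_of_mem {L : Submodule F (Fin (n + 1) → F)} (hL : IsLine L)
    {u v : Fin (n + 1) → F} (hu : u ≠ 0) (huL : u ∈ L) (hvL : v ∈ L) (hv : v ∉ span F {u}) :
    span F {u} ⊔ span F {v} = L :=
  sup_span_singleton_eq ((span_singleton_le_iff_mem _ _).mpr huL) hvL hv
    (by rw [hL, finrank_span_singleton hu])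

lemma mem_span_of_mem_lines {L M : Submodule F (Fin (n + 1) → F)} (hL : IsLine L)
    (hM : IsLine M) (h : L ≠ M) {u v : Fin (n + 1) → F} (hu : u ≠ 0) (huL : u ∈ L) (huM : u ∈ M)
    (hvL : v ∈ L) (hvM : v ∈ M) : v ∈ span F {u} := by
  by_contra hv
  exact h ((line_eq_of_mem hL hu huL hvL hv).symm.trans (line_eq_of_mem hM hu huM hvM hv))

lemma mk_eq_of_mem_span {P Q : Pt F n} (h : P.rep ∈ span F {Q.rep}) : P = Q := by
  obtain ⟨a, ha⟩ := mem_span_singleton.mp h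
  rw [← P.mk_rep, ← Q.mk_rep, Projectivization.mk_eq_mk_iff']
  exact ⟨a, ha⟩

variable [Fintype F]

lemma card_val_eq_zero_le (c : Pt F n → ZMod p) {L : Submodule F (Fin (n + 1) → F)}
    {u v : Fin (n + 1) → F} (hu : u ≠ 0) (hv : v ∉ span F {u})
    (hL : span F {u} ⊔ span F {v} = L) (hlong : Fintype.card F - 3 ≤ wtRes c L) :
    (Finset.univ.filter fun y : F => val c (v + y • u) = 0).card ≤ 4 := by
  rw [← hL, wtRes_span_pair c hu hv, cnt_span_singleton c hu] at hlong
  have h := Finset.card_filter_add_card_filter_not (s := (Finset.univ : Finset F))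
    (fun y => val c (v + y • u) = 0)
  rw [Finset.card_univ] at h
  simp only [ne_eq] at hlong
  split_ifs at hlong <;> omega

/-- Three long lines and a further support point in a plane generate many support points. -/
lemma le_wtRes_of_long_lines (c : Pt F n → ZMod p)
    (hdich : ∀ L, IsLine L → wtRes c L ≤ 3 ∨ Fintype.card F - 3 ≤ wtRes c L)
    {W : Submodule F (Fin (n + 1) → F)} (hW : IsPlane W) {u : Fin (n + 1) → F} (hu : u ∈ W)
    (hcu : val c u ≠ 0) (L : Fin 3 → Submodule F (Fin (n + 1) → F)) (hinj : L.Injective)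
    (hL : ∀ i, IsLine (L i)) (hLW : ∀ i, L i ≤ W)
    (hlong : ∀ i, Fintype.card F - 3 ≤ wtRes c (L i)) (huL : ∀ i, u ∉ L i) :
    1 + (Fintype.card F - 15) * (Fintype.card F - 4) ≤ wtRes c W := by
  have hu0 := ne_zero_of_val_ne_zero hcu
  have hsup : ∀ i, L i ⊔ span F {u} = W := fun i =>
    sup_span_singleton_eq (hLW i) hu (huL i) (by rw [hL i, hW])
  obtain ⟨b, hb, hb0⟩ : ∃ b ∈ L 0, b ≠ 0 := by
    by_contra! h0
    have h1 := hL 0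
    rw [IsLine, (Submodule.eq_bot_iff _).mpr h0, finrank_bot] at h1
    omega
  obtain ⟨a, ha, hab, hL0⟩ := exists_line_eq (hL 0) hb0 hb
  have hproj : ∀ (v : Fin (n + 1) → F), v ∈ L 0 → ∀ i, ∃ t : F, v + t • u ∈ L i := by
    intro v hv i
    have hvW := hLW 0 hv
    rw [← hsup i] at hvW
    obtain ⟨l, hl, z, hz, hlz⟩ := mem_sup.mp hvW
    obtain ⟨t, rfl⟩ := mem_span_singleton.mp hz
    refine ⟨-t, ?_⟩
    rw [← hlz, neg_smul, add_neg_cancel_right]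
    exact hl
  choose α hα using hproj a ha
  choose β hβ using hproj b hb
  have hubn : u ∉ span F {b} := fun h => huL 0 ((span_singleton_le_iff_mem _ _).mpr hb h)
  have haub : a ∉ span F {b} ⊔ span F {u} := notMem_sup_span_comm hab (by rw [hL0]; exact huL 0)
  have hbu : b ∉ span F {u} := by
    have := notMem_sup_span_comm (U := ⊥) (v := b) (w := u) (by simpa using hb0)
      (by rwa [bot_sup_eq])
    rwa [bot_sup_eq] at this
  have haub' : a ∉ span F {u} ⊔ span F {b} := by rwa [sup_comm]
  have hbi : ∀ i, b + β i • u ≠ 0 := fun i => notMem_span_singleton_add hbu _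
  have hai : ∀ i, a + α i • u ∉ span F {b + β i • u} := by
    intro i h
    obtain ⟨t, ht⟩ := mem_span_singleton.mp h
    refine haub' ?_
    have : a = (t * β i - α i) • u + t • b := by
      rw [eq_sub_of_add_eq ht.symm]
      module
    rw [this]
    exact add_mem (mem_sup_left (smul_mem _ _ (mem_span_singleton_self u)))
      (mem_sup_right (smul_mem _ _ (mem_span_singleton_self b)))
  have hLi : ∀ i, span F {b + β i • u} ⊔ span F {a + α i • u} = L i := fun i =>
    line_eq_of_mem (hL i) (hbi i) (hβ i) (hα i) (hai i)
  let E : Finset F := Finset.univ.biUnion fun i : Fin 3 => Finset.univ.filter fun y : F =>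
    val c (a + α i • u + y • (b + β i • u)) = 0
  have hE : E.card ≤ 12 := by
    refine (Finset.card_biUnion_le_card_mul _ _ 4 fun i _ => ?_).trans (by simp)
    exact card_val_eq_zero_le c (hbi i) (hai i) (hLi i) (hlong i)
  let pairs : Finset (Fin 3 × Fin 3) := {(0, 1), (0, 2), (1, 2)}
  let G : Finset F := pairs.biUnion fun s => Finset.univ.filter fun y : F =>
    α s.1 + y * β s.1 = α s.2 + y * β s.2
  have hG : G.card ≤ 3 := by
    refine (Finset.card_biUnion_le_card_mul pairs _ 1 fun s hs => ?_).trans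
      (by simpa using Finset.card_le_three)
    have hne : s.1 ≠ s.2 := by
      simp only [pairs, Finset.mem_insert, Finset.mem_singleton] at hs
      rcases hs with rfl | rfl | rfl <;> decide
    rw [Finset.card_le_one]
    intro y hy z hz
    simp only [Finset.mem_filter, Finset.mem_univ, true_and] at hy hz
    by_contra hyz
    have h1 : (y - z) * (β s.1 - β s.2) = 0 := by linear_combination hy - hz
    have h2 : β s.1 = β s.2 :=
      sub_eq_zero.mp ((mul_eq_zero.mp h1).resolve_left (sub_ne_zero.mpr hyz))
    have h3 : α s.1 = α s.2 := by rw [h2] at hy; exact add_right_cancel hy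
    exact hne (hinj (by rw [← hLi s.1, ← hLi s.2, h2, h3]))
  have hgood : ∀ y ∈ Finset.univ \ (E ∪ G), Fintype.card F - 4 ≤ cnt c (span F {u}) (a + y • b) := by
    intro y hy
    simp only [Finset.mem_sdiff, Finset.mem_univ, true_and, Finset.mem_union, not_or] at hy
    have hyE : ∀ i, val c (a + y • b + (α i + y * β i) • u) ≠ 0 := by
      intro i h0
      refine hy.1 (Finset.mem_biUnion.mpr ⟨i, Finset.mem_univ _, ?_⟩)
      simp only [Finset.mem_filter, Finset.mem_univ, true_and]
      rw [← h0]
      congr 1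
      module
    have hyG : Function.Injective fun i => α i + y * β i := by
      have h : ∀ s ∈ pairs, α s.1 + y * β s.1 ≠ α s.2 + y * β s.2 := fun s hs h0 =>
        hy.2 (Finset.mem_biUnion.mpr ⟨s, hs, by simpa using h0⟩)
      have h01 := h (0, 1) (by simp [pairs])
      have h02 := h (0, 2) (by simp [pairs])
      have h12 := h (1, 2) (by simp [pairs])
      intro i j hij
      fin_cases i <;> fin_cases j <;> simp_all
    have h3 : 3 ≤ cnt c (span F {u}) (a + y • b) := by
      rw [cnt_span_singleton c hu0]
      calc 3 = ((Finset.univ : Finset (Fin 3)).image fun i => α i + y * β i).card := by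
            rw [Finset.card_image_of_injective _ hyG]; simp
        _ ≤ _ := Finset.card_le_card fun x hx => by
            obtain ⟨i, -, rfl⟩ := Finset.mem_image.mp hx
            simpa using hyE i
    have hay : a + y • b ∉ span F {u} := fun h => haub' (by
      have := sub_mem (mem_sup_left h : a + y • b ∈ span F {u} ⊔ span F {b})
        (mem_sup_right (smul_mem _ y (mem_span_singleton_self b)))
      rwa [add_sub_cancel_right] at this)
    have h4 := hdich _ (isLine_span_pair hu0 hay)
    rw [wtRes_span_pair c hu0 hay, if_pos hcu] at h4
    omega
  have hWe : span F {u} ⊔ span F {b} ⊔ span F {a} = W := by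
    rw [← hsup 0, ← hL0]
    ac_rfl
  rw [← hWe, wtRes_sup c haub', cnt_sup c hbu, wtRes_span_pair c hu0 hbu, if_pos hcu]
  have h5 : (Fintype.card F - 15) * (Fintype.card F - 4)
      ≤ ∑ y : F, cnt c (span F {u}) (a + y • b) := by
    calc (Fintype.card F - 15) * (Fintype.card F - 4)
        ≤ (Finset.univ \ (E ∪ G)).card * (Fintype.card F - 4) := by
          refine Nat.mul_le_mul_right _ ?_
          have h6 := Finset.card_union_le E G
          have h7 := Finset.le_card_sdiff (E ∪ G) (Finset.univ : Finset F)
          rw [Finset.card_univ] at h7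
          omega
      _ ≤ ∑ y ∈ Finset.univ \ (E ∪ G), cnt c (span F {u}) (a + y • b) := by
          rw [← smul_eq_mul]
          exact Finset.card_nsmul_le_sum _ _ _ hgood
      _ ≤ _ := Finset.sum_le_sum_of_subset (Finset.subset_univ _)
  omega

lemma exists_val_eq_zero (c : Pt F n → ZMod p) {L : Submodule F (Fin (n + 1) → F)}
    (hL : IsLine L) (h : wtRes c L ≤ Fintype.card F) : ∃ u ∈ L, u ≠ 0 ∧ val c u = 0 := by
  by_contra! h0
  have := wtRes_line_of_forall c hL h0
  omega

/-- In a plane with a `3`-secant and not too many support points, the support is contained in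
three long lines. -/
lemma exists_long_lines [Fact p.Prime] [CharP F p] (hq : 29 ≤ Fintype.card F)
    {c : Pt F n → ZMod p} (hc : c ∈ code F p n)
    (hdich : ∀ L, IsLine L → wtRes c L ≤ 3 ∨ Fintype.card F - 3 ≤ wtRes c L)
    {W l : Submodule F (Fin (n + 1) → F)} (hW : IsPlane W) (hl : IsLine l) (hlW : l ≤ W)
    (hl3 : wtRes c l = 3)
    (hlight : wtRes c W < 1 + (Fintype.card F - 15) * (Fintype.card F - 4)) :
    ∃ M : Fin 3 → Submodule F (Fin (n + 1) → F), M.Injective ∧ (∀ i, IsLine (M i)) ∧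
      (∀ i, M i ≤ W) ∧ (∀ i, Fintype.card F - 3 ≤ wtRes c (M i)) ∧
      (∀ u ∈ W, val c u ≠ 0 → ∃ i, u ∈ M i) ∧
      (∀ L, IsLine L → L ≤ W → Fintype.card F - 3 ≤ wtRes c L → ∃ i, L = M i) ∧
      ∀ u ∈ l, u ≠ 0 → ∀ i, u ∈ M i → val c u ≠ 0 := by
  obtain ⟨u₀, hu₀l, hu₀, hcu₀⟩ := exists_val_eq_zero c hl (by omega)
  obtain ⟨w, hw, hwl, hwW⟩ := exists_plane_eq hl hW hlW
  have hNW : 3 + 3 * (Fintype.card F - 3) ≤ wtRes c W := by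
    rw [← hwW, wtRes_sup c hwl, hl3]
    have := wtRes_mul_le_cnt hc hl hu₀ hu₀l hcu₀ hwl
    rw [hl3] at this
    omega
  obtain ⟨P₀, P₁, P₂, h01, h02, h12, hP⟩ := Set.ncard_eq_three.mp hl3
  let P : Fin 3 → Pt F n := ![P₀, P₁, P₂]
  have hPinj : P.Injective := by
    intro i j hij
    fin_cases i <;> fin_cases j <;> simp_all [P]
  have hPmem : ∀ i, P i ∈ ptsIn l ∩ supp c := by
    intro i
    rw [hP]
    fin_cases i <;> simp [P]
  have hPl : ∀ i, (P i).rep ∈ l := fun i => (ptIn_iff_rep_mem _ _).mp (hPmem i).1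
  have hPc : ∀ i, val c (P i).rep ≠ 0 := fun i => by rw [val_rep]; exact (hPmem i).2
  have hM : ∀ i, ∃ M, IsLine M ∧ (P i).rep ∈ M ∧ M ≤ W ∧ Fintype.card F - 3 ≤ wtRes c M := by
    intro i
    by_contra! h0
    have := wtRes_plane_le c hW (P i).rep_nonzero (hlW (hPl i)) fun L hL hPL hLW =>
      (hdich L hL).resolve_right (not_le.mpr (h0 L hL hPL hLW))
    rw [if_pos (hPc i)] at this
    omega
  choose M hML hPM hMW hMlong using hM
  have hlM : ∀ i, l ≠ M i := by
    intro i h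
    have := hMlong i
    rw [← h] at this
    omega
  have hinj : M.Injective := by
    intro i j hij
    refine (hPinj (mk_eq_of_mem_span ?_)).symm
    exact mem_span_of_mem_lines hl (hML i) (hlM i) (P i).rep_nonzero (hPl i) (hPM i) (hPl j)
      (hij ▸ hPM j)
  have hcover : ∀ u ∈ W, val c u ≠ 0 → ∃ i, u ∈ M i := by
    intro u hu hcu
    by_contra! h0
    have := le_wtRes_of_long_lines c hdich hW hu hcu M hinj hML hMW hMlong h0
    omega
  refine ⟨M, hinj, hML, hMW, hMlong, hcover, ?_, ?_⟩
  · intro L hL hLW hlong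
    by_contra! h0
    have hex : ∀ Q ∈ ptsIn L ∩ supp c, ∃ i, Q.rep ∈ M i := fun Q hQ =>
      hcover _ (hLW ((ptIn_iff_rep_mem _ _).mp hQ.1)) (by rw [val_rep]; exact hQ.2)
    let f : Pt F n → Fin 3 := fun Q => if h : ∃ i, Q.rep ∈ M i then h.choose else 0
    have hf : ∀ Q ∈ ptsIn L ∩ supp c, Q.rep ∈ M (f Q) := fun Q hQ => by
      have h := hex Q hQ
      simp only [f, h, dif_pos]
      exact h.choose_spec
    have h3 : wtRes c L ≤ (Set.univ : Set (Fin 3)).ncard := by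
      refine Set.ncard_le_ncard_of_injOn f (fun _ _ => Set.mem_univ _) (fun Q hQ R hR hQR => ?_)
      refine mk_eq_of_mem_span ?_
      exact mem_span_of_mem_lines hL (hML (f R)) (h0 _) R.rep_nonzero
        ((ptIn_iff_rep_mem _ _).mp hR.1) (hf R hR) ((ptIn_iff_rep_mem _ _).mp hQ.1)
        (hQR ▸ hf Q hQ)
    simp at h3
    omega
  · intro u hul hu i hui
    obtain ⟨t, rfl⟩ := mem_span_singleton.mp
      (mem_span_of_mem_lines hl (hML i) (hlM i) (P i).rep_nonzero (hPl i) (hPM i) hul hui)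
    have ht : t ≠ 0 := by
      rintro rfl
      exact hu (zero_smul _ _)
    rw [val_smul c ht]
    exact hPc i

lemma wtRes_le_three_of_light [Fact p.Prime] [CharP F p] (hq : 29 ≤ Fintype.card F)
    {c : Pt F n → ZMod p} (hc : c ∈ code F p n)
    (hdich : ∀ L, IsLine L → wtRes c L ≤ 3 ∨ Fintype.card F - 3 ≤ wtRes c L)
    {W l L : Submodule F (Fin (n + 1) → F)} (hW : IsPlane W) (hl : IsLine l) (hlW : l ≤ W)
    (hl3 : wtRes c l = 3)
    (hlight : wtRes c W < 1 + (Fintype.card F - 15) * (Fintype.card F - 4))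
    (hL : IsLine L) (hLW : L ≤ W) {u : Fin (n + 1) → F} (hu : u ≠ 0) (hul : u ∈ l) (huL : u ∈ L)
    (hcu : val c u = 0) : wtRes c L ≤ 3 := by
  obtain ⟨M, -, -, -, -, -, h1, h2⟩ := exists_long_lines hq hc hdich hW hl hlW hl3 hlight
  refine (hdich L hL).resolve_right fun hlong => ?_
  obtain ⟨i, rfl⟩ := h1 L hL hLW hlong
  exact h2 u hul hu i huL hcu

lemma light_arith (q Q D T X : ℕ) (hq : 29 ≤ q) (hQ : 1 ≤ Q)
    (hD : D ≤ (q - 1) * (4 * (q - 4)) * Q)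
    (hX : ((q - 15) * (q - 4) - 2) * X ≤ q ^ 2 * D)
    (hT : (1 + (q - 15) * (q - 4) - q) * T ≤ q ^ 2 * D)
    (hXT : (q - 9) * (q ^ 3 * Q - q ^ 2 - X) ≤ q * T) : False := by
  obtain ⟨t, rfl⟩ := Nat.exists_eq_add_of_le hq
  have e1 : 29 + t - 15 = t + 14 := by omega
  have e2 : 29 + t - 4 = t + 25 := by omega
  have e3 : 29 + t - 9 = t + 20 := by omega
  have e4 : 29 + t - 1 = t + 28 := by omega
  rw [e1, e2] at hX hT
  rw [e3] at hXT
  rw [e4, e2] at hD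
  have e5 : 1 + (t + 14) * (t + 25) - (29 + t) = t ^ 2 + 38 * t + 322 := by
    have : 1 + (t + 14) * (t + 25) = t ^ 2 + 38 * t + 322 + (29 + t) := by ring
    omega
  rw [e5] at hT
  have hX' : (t ^ 2 + 38 * t + 322) * X ≤ (29 + t) ^ 2 * D := by
    refine le_trans (Nat.mul_le_mul_right _ ?_) hX
    have : (t + 14) * (t + 25) = t ^ 2 + 39 * t + 350 := by ring
    omega
  have h1 : (t + 20) * ((29 + t) ^ 3 * Q) ≤ (29 + t) * T + (t + 20) * ((29 + t) ^ 2 + X) := by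
    have : (29 + t) ^ 3 * Q ≤ ((29 + t) ^ 3 * Q - (29 + t) ^ 2 - X) + ((29 + t) ^ 2 + X) := by
      omega
    calc _ ≤ (t + 20) * (((29 + t) ^ 3 * Q - (29 + t) ^ 2 - X) + ((29 + t) ^ 2 + X)) :=
          Nat.mul_le_mul_left _ this
      _ ≤ _ := by rw [mul_add]; omega
  have h2 := Nat.le_mul_of_pos_right ((29 + t) ^ 2) hQ
  have hpos : 0 < (29 + t) ^ 2 := by positivity
  have h4 : (29 + t) ^ 3 * Q = (29 + t) ^ 2 * ((28 + t) * Q) + (29 + t) ^ 2 * Q := by ring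
  rw [h4] at h1
  clear hX hXT hq h4 e5
  have h9 : (t ^ 2 + 38 * t + 322) * (t + 20) ≤ (49 + 2 * t) * (4 * (t + 25)) := by
    generalize (29 + t) ^ 2 = A at *
    generalize t ^ 2 + 38 * t + 322 = H at *
    have h3 := Nat.mul_le_mul_left H h1
    have h6 := Nat.mul_le_mul_left (H * (t + 20)) h2
    have h7 := Nat.mul_le_mul_left (t + 20) hX'
    have h8 := Nat.mul_le_mul_left (29 + t) hT
    have h5 : A * (H * (t + 20) * ((28 + t) * Q)) ≤ A * ((49 + 2 * t) * D) := by linarith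
    have h10 := Nat.le_of_mul_le_mul_left h5 hpos
    have h11 := Nat.mul_le_mul_left (49 + 2 * t) hD
    refine Nat.le_of_mul_le_mul_right (c := (28 + t) * Q) ?_ (by positivity)
    linarith
  nlinarith [Nat.zero_le (t ^ 3), Nat.zero_le (t ^ 2)]

/-- A plane containing a `3`-secant does not contain too many support points. -/
lemma wtRes_lt_of_three_secant [Fact p.Prime] [CharP F p] (hn : 3 ≤ n)
    (hq : 29 ≤ Fintype.card F) {c : Pt F n → ZMod p} (hc : c ∈ code F p n)
    (hD : suppCard c ≤ (Fintype.card F - 1) * (4 * (Fintype.card F - 4))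
      * Fintype.card F ^ (n - 2))
    {W l : Submodule F (Fin (n + 1) → F)} (hW : IsPlane W) (hl : IsLine l) (hlW : l ≤ W)
    (hl3 : wtRes c l = 3) :
    wtRes c W < 1 + (Fintype.card F - 15) * (Fintype.card F - 4) := by
  have hdich : ∀ L, IsLine L → wtRes c L ≤ 3 ∨ Fintype.card F - 3 ≤ wtRes c L :=
    fun L hL => wtRes_line_dichotomy hn hq hc hD hL
  by_contra! hheavy
  obtain ⟨u, hul, hu, hcu⟩ := exists_val_eq_zero c hl (by omega)
  obtain ⟨v, hv, hvu, hluv⟩ := exists_line_eq hl hu hul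
  obtain ⟨m, hm, hum, hmlong⟩ : ∃ m, IsLine m ∧ u ∈ m ∧ Fintype.card F - 3 ≤ wtRes c m := by
    by_contra! h0
    have h1 := wtRes_plane_le c hW hu (hlW hul) fun L hL huL _ =>
      (hdich L hL).resolve_right (not_le.mpr (h0 L hL huL))
    simp only [hcu, ne_eq, not_true_eq_false, if_false] at h1
    obtain ⟨t, ht⟩ := Nat.exists_eq_add_of_le hq
    have e1 : Fintype.card F - 15 = t + 14 := by omega
    have e2 : Fintype.card F - 4 = t + 25 := by omega
    rw [e1, e2] at hheavy
    rw [ht] at h1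
    nlinarith
  have hpos : ∀ r : Fin (n + 1) → F, r ∉ span F {u} →
      wtRes c (span F {u} ⊔ span F {r}) = cnt c (span F {u}) r := fun r hr => by
    rw [wtRes_span_pair c hu hr]; simp [hcu]
  let T := Finset.univ.filter fun r : Fin (n + 1) → F => cnt c (span F {u}) r = 3
  let Y := Finset.univ.filter fun r : Fin (n + 1) → F => r ∉ l
  let X := Y.filter fun r => 1 + (Fintype.card F - 15) * (Fintype.card F - 4) ≤
    wtRes c (l ⊔ span F {r})
  have hX : ((Fintype.card F - 15) * (Fintype.card F - 4) - 2) * X.card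
      ≤ Fintype.card F ^ 2 * suppCard c := by
    have h1 := mul_card_le_of_le_cnt c l X ((Fintype.card F - 15) * (Fintype.card F - 4) - 2)
      (fun r hr => by
        simp only [X, Y, Finset.mem_filter, Finset.mem_univ, true_and] at hr
        have h2 := hr.2
        rw [wtRes_sup c hr.1, hl3] at h2
        omega)
    rwa [hl] at h1
  have hT : (1 + (Fintype.card F - 15) * (Fintype.card F - 4) - Fintype.card F) * T.card
      ≤ Fintype.card F ^ 2 * suppCard c := by
    have h1 := mul_card_le_of_le_cnt c m T
      (1 + (Fintype.card F - 15) * (Fintype.card F - 4) - Fintype.card F) (fun r hr => by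
        simp only [T, Finset.mem_filter, Finset.mem_univ, true_and] at hr
        have hru : r ∉ span F {u} := by
          intro h
          have h2 := cnt_add c (U := span F {u}) 0 h
          rw [zero_add, hr, cnt_span_singleton c hu] at h2
          have h3 : ∀ x : F, val c (x • u) = 0 := fun x => by
            by_cases hx : x = 0
            · simp [hx, val_zero]
            · rw [val_smul c hx, hcu]
          simp [h3] at h2
        have hrm : r ∉ m := by
          intro h
          have h2 := hpos r hru
          rw [line_eq_of_mem hm hu hum h hru, hr] at h2
          omega
        have h2 : 1 + (Fintype.card F - 15) * (Fintype.card F - 4)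
            ≤ wtRes c (m ⊔ span F {r}) := by
          by_contra! hlight
          have h3 := wtRes_le_three_of_light hq hc hdich (isPlane_sup hm hrm)
            (isLine_span_pair hu hru)
            (sup_le (le_trans ((span_singleton_le_iff_mem _ _).mpr hum) le_sup_left) le_sup_right)
            ((hpos r hru).trans hr) hlight hm le_sup_left hu
            (mem_sup_left (mem_span_singleton_self u)) hum hcu
          omega
        rw [wtRes_sup c hrm] at h2
        have h3 := wtRes_line_le c hm hu hum hcu
        omega)
    rwa [hm] at h1
  have hcount : ∀ r ∈ Y \ X, Fintype.card F - 9 ≤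
      (Finset.univ.filter fun y : F => r + y • v ∈ T).card := by
    intro r hr
    simp only [X, Y, Finset.mem_sdiff, Finset.mem_filter, Finset.mem_univ, true_and, not_and,
      not_le] at hr
    obtain ⟨hrl, hlight⟩ := hr
    have hlight := hlight hrl
    have h1 := wtRes_mul_le_cnt hc hl hu hul hcu hrl
    rw [hl3, ← hluv, cnt_sup c hvu] at h1
    have h2 : ∀ y : F, cnt c (span F {u}) (r + y • v) ≤ 2 + if r + y • v ∈ T then 1 else 0 := by
      intro y
      have hyl : r + y • v ∉ l := fun h => hrl ((l.add_mem_iff_left (l.smul_mem y hv)).mp h)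
      have hyu : r + y • v ∉ span F {u} := fun h =>
        hyl ((span_singleton_le_iff_mem _ _).mpr hul h)
      have h3 : cnt c (span F {u}) (r + y • v) ≤ 3 := by
        rw [← hpos _ hyu]
        refine wtRes_le_three_of_light hq hc hdich (isPlane_sup hl hrl) hl le_sup_left hl3 hlight
          (isLine_span_pair hu hyu) (sup_le ?_ ?_) hu hul
          (mem_sup_left (mem_span_singleton_self u)) hcu
        · exact le_trans ((span_singleton_le_iff_mem _ _).mpr hul) le_sup_left
        · rw [span_singleton_le_iff_mem]
          exact add_mem (mem_sup_right (mem_span_singleton_self r))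
            (mem_sup_left (l.smul_mem y hv))
      simp only [T, Finset.mem_filter, Finset.mem_univ, true_and]
      split_ifs <;> omega
    have h4 := h1.trans (Finset.sum_le_sum fun y _ => h2 y)
    rw [Finset.sum_add_distrib, Finset.sum_const, Finset.card_univ, ← Finset.card_filter,
      smul_eq_mul] at h4
    omega
  have hdouble : ∑ r : Fin (n + 1) → F, (Finset.univ.filter fun y : F => r + y • v ∈ T).card
      = Fintype.card F * T.card := by
    simp only [Finset.card_filter]
    rw [Finset.sum_comm]
    have : ∀ y : F, ∑ r : Fin (n + 1) → F, (if r + y • v ∈ T then 1 else 0) = T.card := fun y => by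
      exact (Equiv.sum_comp (Equiv.addRight (y • v)) fun r => if r ∈ T then 1 else 0).trans
        (by simp)
    simp [this]
  have hXT : (Fintype.card F - 9) * (Y.card - X.card) ≤ Fintype.card F * T.card := by
    rw [← hdouble, mul_comm]
    calc (Y.card - X.card) * (Fintype.card F - 9)
        ≤ (Y \ X).card * (Fintype.card F - 9) :=
          Nat.mul_le_mul_right _ (Finset.le_card_sdiff _ _)
      _ ≤ _ := by
          rw [← smul_eq_mul]
          exact (Finset.card_nsmul_le_sum _ _ _ hcount).trans
            (Finset.sum_le_sum_of_subset (Finset.subset_univ _))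
  have hY : Y.card = Fintype.card F ^ (n + 1) - Fintype.card F ^ 2 := by
    rw [card_notMem, hl]
  have hpow : Fintype.card F ^ (n + 1) = Fintype.card F ^ 3 * Fintype.card F ^ (n - 2) := by
    rw [← pow_add]
    congr 1
    omega
  rw [hY, hpow] at hXT
  exact light_arith _ _ _ _ _ hq (Nat.one_le_pow _ _ (by omega)) hD hX hT hXT

end Planes

section Classification

open Submodule Module

variable {n p : ℕ}

lemma exists_mem_inf_lines {L M W : Submodule F (Fin (n + 1) → F)} (hL : IsLine L)
    (hM : IsLine M) (hW : IsPlane W) (hLW : L ≤ W) (hMW : M ≤ W) :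
    ∃ v, v ≠ 0 ∧ v ∈ L ∧ v ∈ M := by
  have h1 := Submodule.finrank_sup_add_finrank_inf_eq L M
  have h2 := Submodule.finrank_mono (sup_le hLW hMW)
  rw [hL, hM] at h1
  rw [hW] at h2
  by_contra! h0
  have h3 : L ⊓ M = ⊥ := (Submodule.eq_bot_iff _).mpr fun v hv => by
    by_contra hv0
    exact h0 v hv0 hv.1 hv.2
  rw [h3, finrank_bot] at h1
  omega

lemma forall_ptIn_iff {Q : Pt F n → Prop} {W : Submodule F (Fin (n + 1) → F)} :
    (∀ P, ptIn P W → Q P) ↔ ∀ v (hv : v ≠ 0), v ∈ W → Q (Projectivization.mk F v hv) := by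
  refine ⟨fun h v hv hvW => h _ ((ptIn_mk _ _ _).mpr hvW), fun h P hP => ?_⟩
  rw [← P.mk_rep]
  exact h _ _ ((ptIn_iff_rep_mem _ _).mp hP)

lemma incVec_mk (v : Fin (n + 1) → F) (hv : v ≠ 0) (W : Submodule F (Fin (n + 1) → F)) :
    incVec p W (Projectivization.mk F v hv) = if v ∈ W then 1 else 0 := by
  simp only [incVec, ptIn_mk]

lemma wtRes_le_two_of_forall [Fintype F] (c : Pt F n → ZMod p)
    {L : Submodule F (Fin (n + 1) → F)} {u v : Fin (n + 1) → F} (hu : u ≠ 0)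
    (hv : v ∉ span F {u}) (hL : span F {u} ⊔ span F {v} = L)
    (h : ∀ x : F, x ≠ 0 → val c (v + x • u) = 0) : wtRes c L ≤ 2 := by
  rw [← hL, wtRes_span_pair c hu hv, cnt_span_singleton c hu]
  have h1 : (Finset.univ.filter fun x : F => val c (v + x • u) ≠ 0) ⊆ {0} := by
    intro x hx
    simp only [Finset.mem_filter, Finset.mem_univ, true_and] at hx
    rw [Finset.mem_singleton]
    by_contra h0
    exact hx (h x h0)
  have h2 := Finset.card_le_card h1
  rw [Finset.card_singleton] at h2
  split_ifs <;> omega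

lemma forall_fin_three {P : Fin 3 → Prop} (h0 : P 0) (h1 : P 1) (h2 : P 2) (j : Fin 3) : P j := by
  fin_cases j <;> assumption

lemma typeTri_of_support [Fintype F] {c : Pt F n → ZMod p} {k : ZMod p}
    (hk : ∀ u v : Fin (n + 1) → F, u ≠ 0 → v ∉ span F {u} →
      val c u + ∑ x : F, val c (v + x • u) = k)
    {W : Submodule F (Fin (n + 1) → F)} (hW : IsPlane W)
    (M : Fin 3 → Submodule F (Fin (n + 1) → F)) (hinj : M.Injective) (hM : ∀ i, IsLine (M i))
    (hMW : ∀ i, M i ≤ W) (hlong : ∀ i, 3 ≤ wtRes c (M i))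
    (hout : ∀ u ∈ W, (∀ i, u ∉ M i) → val c u = 0)
    (hconc : ¬ ∃ o, o ≠ 0 ∧ ∀ i, o ∈ M i) : TypeTri p c W := by
  have hex : ∀ i : Fin 3, ∃ v, v ≠ 0 ∧ v ∈ M (i + 1) ∧ v ∈ M (i + 2) := fun i =>
    exists_mem_inf_lines (hM _) (hM _) hW (hMW _) (hMW _)
  choose v hv0 hv1 hv2 using hex
  have hcases : ∀ i j : Fin 3, j = i ∨ j = i + 1 ∨ j = i + 2 := by decide
  have hadd : ∀ i : Fin 3, i ≠ i + 1 ∧ i ≠ i + 2 ∧ i + 1 ≠ i + 2 := by decide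
  have hvM : ∀ i j, j ≠ i → v i ∈ M j := by
    intro i j hij
    rcases hcases i j with h | rfl | rfl
    · exact absurd h hij
    · exact hv1 i
    · exact hv2 i
  have hvn : ∀ i, v i ∉ M i := fun i h => hconc ⟨v i, hv0 i, fun j => by
    by_cases hj : j = i
    · exact hj ▸ h
    · exact hvM i j hj⟩
  have hmem : ∀ i (x : Fin 3 → F), ∑ j, x j • v j ∈ M i ↔ x i = 0 := by
    intro i x
    rw [← Finset.add_sum_erase _ _ (Finset.mem_univ i), Submodule.add_mem_iff_left]
    · refine ⟨fun h => ?_, fun h => by rw [h, zero_smul]; exact zero_mem _⟩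
      by_contra hx
      exact hvn i (((M i).smul_mem_iff hx).mp h)
    · exact sum_mem fun j hj => (M i).smul_mem _ (hvM j i (Finset.ne_of_mem_erase hj).symm)
  have hvW : ∀ i, v i ∈ W := fun i => hMW _ (hv1 i)
  have hsumW : ∀ x : Fin 3 → F, ∑ j, x j • v j ∈ W := fun x =>
    sum_mem fun j _ => W.smul_mem _ (hvW j)
  have hpair : ∀ i j, i ≠ j → v j ∉ span F {v i} := by
    intro i j hij h
    obtain ⟨t, ht⟩ := mem_span_singleton.mp h
    have h1 : t • v i ∈ M i := by rw [ht]; exact hvM j i hij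
    by_cases ht0 : t = 0
    · rw [ht0, zero_smul] at ht
      exact hv0 j ht.symm
    · exact hvn i (((M i).smul_mem_iff ht0).mp h1)
  have hspan : ∀ u ∈ W, ∃ x : Fin 3 → F, u = ∑ j, x j • v j := by
    intro u hu
    have h1 := line_eq_of_mem (hM 0) (hv0 1) (hvM 1 0 (by decide)) (hvM 2 0 (by decide))
      (hpair 1 2 (by decide))
    have h2 := sup_span_singleton_eq (hMW 0) (hvW 0) (hvn 0) (by rw [hM 0, hW])
    rw [← h2, ← h1] at hu
    obtain ⟨s, hs, r, hr, rfl⟩ := mem_sup.mp hu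
    obtain ⟨s1, hs1, s2, hs2, rfl⟩ := mem_sup.mp hs
    obtain ⟨x0, rfl⟩ := mem_span_singleton.mp hr
    obtain ⟨x1, rfl⟩ := mem_span_singleton.mp hs1
    obtain ⟨x2, rfl⟩ := mem_span_singleton.mp hs2
    refine ⟨![x0, x1, x2], ?_⟩
    rw [Fin.sum_univ_three]
    simp only [Matrix.cons_val_zero, Matrix.cons_val_one, Matrix.cons_val]
    abel
  have hzero : ∀ x : Fin 3 → F, (∀ i, x i ≠ 0) → val c (∑ j, x j • v j) = 0 := fun x hx =>
    hout _ (hsumW x) fun i h => hx i ((hmem i x).mp h)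
  have hshift : ∀ (x : Fin 3 → F) (i : Fin 3) (y : F), ∑ j, x j • v j + y • v i
      = ∑ j, (x j + if j = i then y else 0) • v j := by
    intro x i y
    simp only [add_smul, Finset.sum_add_distrib]
    simp
  have hedge : ∀ (i : Fin 3) (x : Fin 3 → F), x i = 0 → (∀ j, j ≠ i → x j ≠ 0) →
      val c (∑ j, x j • v j) = k - val c (v i) := by
    intro i x hxi hxj
    have hns : ∑ j, x j • v j ∉ span F {v i} := by
      intro h
      obtain ⟨t, ht⟩ := mem_span_singleton.mp h
      have h1 : ∑ j, x j • v j ∈ M (i + 1) := by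
        rw [← ht]; exact (M _).smul_mem _ (hv1 i)
      exact hxj _ (hadd i).1.symm ((hmem _ _).mp h1)
    rw [← hk (v i) _ (hv0 i) hns, Fintype.sum_eq_single (0 : F)]
    · rw [zero_smul, add_zero]; ring
    · intro y hy
      rw [hshift]
      refine hzero _ fun j => ?_
      by_cases hj : j = i
      · rw [hj, hxi]; simpa using hy
      · simpa [hj] using hxj j hj
  have hk3 : (k - val c (v 0)) + (k - val c (v 1)) + (k - val c (v 2)) = k := by
    have h0 := hedge 0 ![0, 1, 1] (by simp) (forall_fin_three (fun h => absurd rfl h) (by simp) (by simp))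
    have h1 := hedge 1 ![1, 0, 1] (by simp) (forall_fin_three (by simp) (fun h => absurd rfl h) (by simp))
    have h2 := hedge 2 ![1, -1, 0] (by simp) (forall_fin_three (by simp) (by simp) (fun h => absurd rfl h))
    have hu0 : ∑ j, (![0, 1, 1] : Fin 3 → F) j • v j ≠ 0 := by
      intro h
      have := (hmem 1 ![0, 1, 1]).mp (by rw [h]; exact zero_mem _)
      simp at this
    have hns : ∑ j, (![1, 0, 1] : Fin 3 → F) j • v j ∉
        span F {∑ j, (![0, 1, 1] : Fin 3 → F) j • v j} := by
      intro h
      have h5 : ∑ j, (![1, 0, 1] : Fin 3 → F) j • v j ∈ M 0 :=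
        (span_singleton_le_iff_mem _ _).mpr ((hmem 0 ![0, 1, 1]).mpr (by simp)) h
      have := (hmem 0 _).mp h5
      simp at this
    have hcomb : ∀ x : F, ∑ j, (![1, 0, 1] : Fin 3 → F) j • v j
        + x • ∑ j, (![0, 1, 1] : Fin 3 → F) j • v j = ∑ j, (![1, x, 1 + x] : Fin 3 → F) j • v j := by
      intro x
      simp only [Fin.sum_univ_three, Matrix.cons_val_zero, Matrix.cons_val_one, Matrix.cons_val]
      module
    rw [← h0, ← h1, ← h2, ← hk _ _ hu0 hns, Fintype.sum_eq_add (0 : F) (-1) (by simp), hcomb, hcomb]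
    · simp [add_assoc]
    · rintro x ⟨hx0, hx1⟩
      rw [hcomb]
      refine hzero _ fun j => ?_
      fin_cases j
      · simp
      · simpa using hx0
      · simp only [Fin.reduceFinMk, Matrix.cons_val]
        intro h
        exact hx1 (by linear_combination h)
  have hne : ∀ i, k - val c (v i) ≠ 0 := by
    intro i h0
    have hij := hadd i
    have h1 := wtRes_le_two_of_forall c (hv0 (i + 1)) (hpair (i + 1) (i + 2) hij.2.2)
      (line_eq_of_mem (hM i) (hv0 _) (hvM _ _ hij.1) (hvM _ _ hij.2.1) (hpair _ _ hij.2.2))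
      (fun x hx => by
        have h2 := hedge i (fun j => (if j = i + 2 then 1 else 0) + if j = i + 1 then x else 0)
          (by simp [hij.1, hij.2.1]) (by
            intro j hj
            rcases hcases i j with h | rfl | rfl
            · exact absurd h hj
            · simp [hij.2.2, hx]
            · simp [hij.2.2.symm])
        rw [h0] at h2
        rw [← h2]
        congr 1
        simp [add_smul, Finset.sum_add_distrib])
    have := hlong i
    omega
  refine ⟨M 0, M 1, M 2, hM 0, hM 1, hM 2, hMW 0, hMW 1, hMW 2, hinj.ne (by decide),
    hinj.ne (by decide), hinj.ne (by decide), ?_, _, _, _, hne 0, hne 1, hne 2, ?_⟩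
  · rintro ⟨P, h0, h1, h2⟩
    refine hconc ⟨P.rep, P.rep_nonzero, fun i => ?_⟩
    fin_cases i
    · exact (ptIn_iff_rep_mem _ _).mp h0
    · exact (ptIn_iff_rep_mem _ _).mp h1
    · exact (ptIn_iff_rep_mem _ _).mp h2
  · rw [forall_ptIn_iff]
    intro u hu huW
    rw [← val_of_ne_zero c hu]
    simp only [incVec_mk]
    obtain ⟨x, rfl⟩ := hspan u huW
    simp only [hmem]
    have hvert : ∀ i, (∀ j, j ≠ i → x j = 0) → val c (∑ j, x j • v j) = val c (v i) := by
      intro i h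
      rw [Finset.sum_eq_single i (fun j _ hj => by rw [h j hj, zero_smul]) (by simp)]
      refine val_smul c ?_ _
      intro hxi
      apply hu
      refine Finset.sum_eq_zero fun j _ => ?_
      by_cases hj : j = i
      · rw [hj, hxi, zero_smul]
      · rw [h j hj, zero_smul]
    by_cases h0 : x 0 = 0 <;> by_cases h1 : x 1 = 0 <;> by_cases h2 : x 2 = 0
    · exact absurd (by simp [Fin.sum_univ_three, h0, h1, h2]) hu
    · rw [hvert 2 (forall_fin_three (fun _ => h0) (fun _ => h1) (fun h => absurd rfl h))]
      simp only [h0, h1, h2, if_true, if_false]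
      linear_combination -hk3
    · rw [hvert 1 (forall_fin_three (fun _ => h0) (fun h => absurd rfl h) (fun _ => h2))]
      simp only [h0, h1, h2, if_true, if_false]
      linear_combination -hk3
    · rw [hedge 0 x h0 (forall_fin_three (fun h => absurd rfl h) (fun _ => h1) (fun _ => h2))]
      simp [h0, h1, h2]
    · rw [hvert 0 (forall_fin_three (fun h => absurd rfl h) (fun _ => h1) (fun _ => h2))]
      simp only [h0, h1, h2, if_true, if_false]
      linear_combination -hk3
    · rw [hedge 1 x h1 (forall_fin_three (fun _ => h0) (fun h => absurd rfl h) (fun _ => h2))]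
      simp [h0, h1, h2]
    · rw [hedge 2 x h2 (forall_fin_three (fun _ => h0) (fun _ => h1) (fun h => absurd rfl h))]
      simp [h0, h1, h2]
    · rw [hzero x (forall_fin_three h0 h1 h2)]
      simp [h0, h1, h2]

end Classification

section Frames

open Submodule Module

variable {n p : ℕ} {b : Fin 3 → Fin (n + 1) → F} {W : Submodule F (Fin (n + 1) → F)}

lemma eq_zero_of_sum_smul_eq_zero (hb : LinearIndependent F b) {x : Fin 3 → F}
    (h : ∑ j, x j • b j = 0) : x = 0 :=
  funext fun i => Fintype.linearIndependent_iff.mp hb x h i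

lemma eq_of_sum_smul_eq (hb : LinearIndependent F b) {x y : Fin 3 → F}
    (h : ∑ j, x j • b j = ∑ j, y j • b j) : x = y := by
  rw [← sub_eq_zero]
  refine eq_zero_of_sum_smul_eq_zero hb ?_
  simp only [Pi.sub_apply, sub_smul, Finset.sum_sub_distrib, h, sub_self]

lemma exists_eq_sum_smul (hW : span F (Set.range b) = W) {u : Fin (n + 1) → F} (hu : u ∈ W) :
    ∃ x : Fin 3 → F, u = ∑ j, x j • b j := by
  rw [← hW, mem_span_range_iff_exists_fun] at hu
  obtain ⟨x, hx⟩ := hu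
  exact ⟨x, hx.symm⟩

lemma sum_smul_mem (hW : span F (Set.range b) = W) (x : Fin 3 → F) : ∑ j, x j • b j ∈ W := by
  rw [← hW, mem_span_range_iff_exists_fun]
  exact ⟨x, rfl⟩

lemma smul_add_smul_notMem (hb : LinearIndependent F b) {r s : F} (h : r ≠ 0 ∨ s ≠ 0) :
    r • b 0 + s • b 1 ∉ span F {b 2} := by
  intro hm
  obtain ⟨z, hz⟩ := mem_span_singleton.mp hm
  have h1 := eq_of_sum_smul_eq hb (x := ![0, 0, z]) (y := ![r, s, 0])
    (by simpa [Fin.sum_univ_three] using hz)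
  have h2 := congrFun h1 0
  have h3 := congrFun h1 1
  simp only [Matrix.cons_val_zero, Matrix.cons_val_one] at h2 h3
  rcases h with h | h
  · exact h h2.symm
  · exact h h3.symm

lemma sum_smul_mem_line_iff (hb : LinearIndependent F b) {r s : F} (h : r ≠ 0 ∨ s ≠ 0)
    (x : Fin 3 → F) :
    ∑ j, x j • b j ∈ span F {b 2} ⊔ span F {r • b 0 + s • b 1} ↔ x 0 * s = x 1 * r := by
  constructor
  · intro hm
    obtain ⟨y, hy, z, hz, hyz⟩ := mem_sup.mp hm
    obtain ⟨y, rfl⟩ := mem_span_singleton.mp hy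
    obtain ⟨z, rfl⟩ := mem_span_singleton.mp hz
    have h1 := eq_of_sum_smul_eq hb (x := x) (y := ![z * r, z * s, y]) (by
      rw [← hyz]
      simp only [Fin.sum_univ_three, Matrix.cons_val_zero, Matrix.cons_val_one, Matrix.cons_val]
      module)
    rw [h1]
    simp only [Matrix.cons_val_zero, Matrix.cons_val_one]
    ring
  · intro hx
    have : ∃ z, x 0 = z * r ∧ x 1 = z * s := by
      rcases h with h | h
      · exact ⟨x 0 / r, by field_simp, by field_simp; linear_combination -hx⟩
      · exact ⟨x 1 / s, by field_simp; linear_combination hx, by field_simp⟩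
    obtain ⟨z, h0, h1⟩ := this
    refine mem_sup.mpr ⟨_, mem_span_singleton.mpr ⟨x 2, rfl⟩, _,
      mem_span_singleton.mpr ⟨z, rfl⟩, ?_⟩
    rw [Fin.sum_univ_three, h0, h1]
    module

lemma line_le (hW : span F (Set.range b) = W) (r s : F) :
    span F {b 2} ⊔ span F {r • b 0 + s • b 1} ≤ W := by
  have h : ∀ i, b i ∈ W := fun i => hW ▸ subset_span (Set.mem_range_self i)
  simp only [sup_le_iff, span_singleton_le_iff_mem]
  exact ⟨h 2, W.add_mem (W.smul_mem _ (h 0)) (W.smul_mem _ (h 1))⟩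

/-- A linear combination of three distinct lines through the point spanned by `b 2`, written in
the coordinates of the frame `b`, gives a plane of type `T^★`. -/
lemma typeStar_of_coordinates {c : Pt F n → ZMod p} (hb : LinearIndependent F b)
    (hW : span F (Set.range b) = W) (r s : Fin 3 → F)
    (hrs : ∀ i j, i ≠ j → r i * s j ≠ r j * s i) (a : Fin 3 → ZMod p) (ha : ∀ i, a i ≠ 0)
    (h : ∀ x : Fin 3 → F, x ≠ 0 → val c (∑ j, x j • b j) =
      ∑ i, a i * if x 0 * s i = x 1 * r i then 1 else 0) : TypeStar p c W := by
  have h0 : ∀ i : Fin 3, r i ≠ 0 ∨ s i ≠ 0 := by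
    intro i
    by_contra! hi
    exact hrs i (i + 1) ((by decide : ∀ i : Fin 3, i ≠ i + 1) i) (by rw [hi.1, hi.2]; ring)
  have hb2 : b 2 ≠ 0 := hb.ne_zero 2
  have hline : ∀ i, IsLine (span F {b 2} ⊔ span F {r i • b 0 + s i • b 1}) := fun i =>
    isLine_span_pair hb2 (smul_add_smul_notMem hb (h0 i))
  have hne : ∀ i j, i ≠ j → span F {b 2} ⊔ span F {r i • b 0 + s i • b 1} ≠
      span F {b 2} ⊔ span F {r j • b 0 + s j • b 1} := by
    intro i j hij heq
    have h1 : ∑ k, (![r i, s i, 0] : Fin 3 → F) k • b k ∈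
        span F {b 2} ⊔ span F {r i • b 0 + s i • b 1} := by
      rw [sum_smul_mem_line_iff hb (h0 i)]
      simp only [Matrix.cons_val_zero, Matrix.cons_val_one]
      ring
    rw [heq, sum_smul_mem_line_iff hb (h0 j)] at h1
    simp only [Matrix.cons_val_zero, Matrix.cons_val_one] at h1
    exact hrs i j hij (by rw [h1]; ring)
  refine ⟨_, _, _, hline 0, hline 1, hline 2, line_le hW _ _, line_le hW _ _, line_le hW _ _,
    hne 0 1 (by decide), hne 0 2 (by decide), hne 1 2 (by decide),
    ⟨Projectivization.mk F (b 2) hb2, ?_⟩, a 0, a 1, a 2, ha 0, ha 1, ha 2, ?_⟩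
  · simp only [ptIn_mk]
    have := fun i => mem_sup_left (T := span F {r i • b 0 + s i • b 1}) (mem_span_singleton_self (R := F) (b 2))
    exact ⟨this 0, this 1, this 2⟩
  · rw [forall_ptIn_iff]
    intro u hu huW
    obtain ⟨x, rfl⟩ := exists_eq_sum_smul hW huW
    have hx : x ≠ 0 := by
      rintro rfl
      simp at hu
    rw [← val_of_ne_zero c hu, h x hx, Fin.sum_univ_three]
    simp only [incVec_mk, sum_smul_mem_line_iff hb (h0 _)]

/-- A linear combination of two lines through the point spanned by `b 2`, written in the
coordinates of the frame `b`. -/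
lemma twoLineComb_of_coordinates {c : Pt F n → ZMod p} (hb : LinearIndependent F b)
    (hW : span F (Set.range b) = W) (r s : Fin 2 → F)
    (h0 : ∀ i, r i ≠ 0 ∨ s i ≠ 0) (a : Fin 2 → ZMod p)
    (h : ∀ x : Fin 3 → F, x ≠ 0 → val c (∑ j, x j • b j) =
      ∑ i, a i * if x 0 * s i = x 1 * r i then 1 else 0) : TwoLineComb p c W := by
  refine ⟨_, _, isLine_span_pair (hb.ne_zero 2) (smul_add_smul_notMem hb (h0 0)),
    isLine_span_pair (hb.ne_zero 2) (smul_add_smul_notMem hb (h0 1)), line_le hW _ _,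
    line_le hW _ _, a 0, a 1, ?_⟩
  rw [forall_ptIn_iff]
  intro u hu huW
  obtain ⟨x, rfl⟩ := exists_eq_sum_smul hW huW
  have hx : x ≠ 0 := by
    rintro rfl
    simp at hu
  rw [← val_of_ne_zero c hu, h x hx, Fin.sum_univ_two]
  simp only [incVec_mk, sum_smul_mem_line_iff hb (h0 _)]

lemma exists_frame_of_concurrent (hW : IsPlane W) (M : Fin 3 → Submodule F (Fin (n + 1) → F))
    (hinj : M.Injective) (hM : ∀ i, IsLine (M i)) (hMW : ∀ i, M i ≤ W)
    {o : Fin (n + 1) → F} (ho : o ≠ 0) (hoM : ∀ i, o ∈ M i) :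
    ∃ b : Fin 3 → Fin (n + 1) → F, LinearIndependent F b ∧ span F (Set.range b) = W ∧
      (∀ x : Fin 3 → F, ∑ j, x j • b j ∈ M 0 ↔ x 0 = 0) ∧
      (∀ x : Fin 3 → F, ∑ j, x j • b j ∈ M 1 ↔ x 1 = 0) ∧
      ∀ x : Fin 3 → F, ∑ j, x j • b j ∈ M 2 ↔ x 0 = x 1 := by
  obtain ⟨m, hm, hmo, -⟩ := exists_line_eq (hM 2) ho (hoM 2)
  have hdisj : ∀ {i j v}, i ≠ j → v ∈ M i → v ∈ M j → v ∈ span F {o} := fun hij hi hj =>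
    mem_span_of_mem_lines (hM _) (hM _) (hinj.ne hij) ho (hoM _) (hoM _) hi hj
  obtain ⟨v, hv, hvo, -⟩ := exists_line_eq (hM 1) ho (hoM 1)
  have hv0 : v ∉ M 0 := fun h => hvo (hdisj (by decide : (1 : Fin 3) ≠ 0) hv h)
  have hsup : M 0 ⊔ span F {v} = W :=
    sup_span_singleton_eq (hMW 0) (hMW 1 hv) hv0 (by rw [hM 0, hW])
  obtain ⟨b1, hb1, b0, hb0, hbm⟩ := mem_sup.mp (hsup ▸ hMW 2 hm)
  replace hb0 : b0 ∈ M 1 := (span_singleton_le_iff_mem _ _).mpr hv hb0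
  have hoS : ∀ i, span F {o} ≤ M i := fun i => (span_singleton_le_iff_mem _ _).mpr (hoM i)
  have hb00 : b0 ∉ M 0 := fun h =>
    hmo (hdisj (by decide : (2 : Fin 3) ≠ 0) hm (hbm ▸ add_mem hb1 h))
  have hb11 : b1 ∉ M 1 := fun h =>
    hmo (hdisj (by decide : (2 : Fin 3) ≠ 1) hm (hbm ▸ add_mem h hb0))
  have hb02 : b0 ∉ M 2 := fun h =>
    hb00 (hoS 0 (hdisj (by decide : (1 : Fin 3) ≠ 2) hb0 h))
  have hsum : ∀ x : Fin 3 → F, ∑ j, x j • (![b0, b1, o] : Fin 3 → Fin (n + 1) → F) j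
      = x 0 • b0 + x 1 • b1 + x 2 • o := by
    intro x
    simp [Fin.sum_univ_three]
  have hkey : ∀ (N : Submodule F (Fin (n + 1) → F)) {v w : Fin (n + 1) → F} (t : F), w ∈ N →
      v ∉ N → (t • v + w ∈ N ↔ t = 0) := by
    intro N v w t hw hv
    rw [N.add_mem_iff_left hw]
    refine ⟨fun h => ?_, fun h => by rw [h, zero_smul]; exact zero_mem _⟩
    by_contra ht
    exact hv ((N.smul_mem_iff ht).mp h)
  have h0 : ∀ x : Fin 3 → F, ∑ j, x j • (![b0, b1, o] : Fin 3 → Fin (n + 1) → F) j ∈ M 0 ↔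
      x 0 = 0 := by
    intro x
    rw [hsum, add_assoc]
    exact hkey _ _ (add_mem ((M 0).smul_mem _ hb1) ((M 0).smul_mem _ (hoM 0))) hb00
  have h1 : ∀ x : Fin 3 → F, ∑ j, x j • (![b0, b1, o] : Fin 3 → Fin (n + 1) → F) j ∈ M 1 ↔
      x 1 = 0 := by
    intro x
    rw [hsum, add_comm (x 0 • b0), add_assoc]
    exact hkey _ _ (add_mem ((M 1).smul_mem _ hb0) ((M 1).smul_mem _ (hoM 1))) hb11
  have h2 : ∀ x : Fin 3 → F, ∑ j, x j • (![b0, b1, o] : Fin 3 → Fin (n + 1) → F) j ∈ M 2 ↔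
      x 0 = x 1 := by
    intro x
    rw [hsum, ← sub_eq_zero, show x 0 • b0 + x 1 • b1 + x 2 • o
      = (x 0 - x 1) • b0 + (x 1 • (b1 + b0) + x 2 • o) by module]
    exact hkey _ _ (add_mem ((M 2).smul_mem _ (hbm ▸ hm)) ((M 2).smul_mem _ (hoM 2))) hb02
  have hb : LinearIndependent F (![b0, b1, o] : Fin 3 → Fin (n + 1) → F) := by
    rw [Fintype.linearIndependent_iff]
    intro x hx
    have hx0 := (h0 x).mp (by rw [hx]; exact zero_mem _)
    have hx1 := (h1 x).mp (by rw [hx]; exact zero_mem _)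
    rw [hsum, hx0, hx1, zero_smul, zero_smul, zero_add, zero_add] at hx
    exact forall_fin_three hx0 hx1 ((smul_eq_zero.mp hx).resolve_right ho)
  refine ⟨_, hb, ?_, h0, h1, h2⟩
  refine Submodule.eq_of_le_of_finrank_eq ?_ ?_
  · rw [span_le]
    rintro _ ⟨i, rfl⟩
    exact forall_fin_three (P := fun i => (![b0, b1, o] : Fin 3 → Fin (n + 1) → F) i ∈ W)
      (hMW 1 hb0) (hMW 0 hb1) (hMW 0 (hoM 0)) i
  · rw [finrank_span_eq_card hb, hW, Fintype.card_fin]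

variable [Fintype F]

/-- The shape of a code word whose support in a plane lies on three concurrent lines. -/
lemma exists_addMonoidHom_of_concurrent (hq : 3 ≤ Fintype.card F) {c : Pt F n → ZMod p}
    {k : ZMod p} (hk : ∀ u v : Fin (n + 1) → F, u ≠ 0 → v ∉ span F {u} →
      val c u + ∑ x : F, val c (v + x • u) = k)
    (hb : LinearIndependent F b)
    (hout : ∀ x : Fin 3 → F, x 0 ≠ 0 → x 1 ≠ 0 → x 0 ≠ x 1 → val c (∑ j, x j • b j) = 0) :
    ∃ (φ : F →+ ZMod p) (α β : ZMod p), ∀ x : Fin 3 → F, x ≠ 0 → val c (∑ j, x j • b j) =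
      (if x 0 = 0 ∧ x 1 ≠ 0 then φ (x 2 / x 1) else if x 1 = 0 ∧ x 0 ≠ 0 then φ (x 2 / x 0)
        else if x 0 = x 1 ∧ x 0 ≠ 0 then -φ (x 2 / x 0) else 0)
      + α * (if x 0 = 0 then 1 else 0) + β * (if x 1 = 0 then 1 else 0)
      + (k - α - β) * (if x 0 = x 1 then 1 else 0) := by
  let f : F → F → F → ZMod p := fun x y z => val c (∑ j, (![x, y, z] : Fin 3 → F) j • b j)
  have hf : ∀ x : Fin 3 → F, val c (∑ j, x j • b j) = f (x 0) (x 1) (x 2) := by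
    intro x
    simp only [f, Fin.sum_univ_three, Matrix.cons_val_zero, Matrix.cons_val_one, Matrix.cons_val]
  have hout' : ∀ x y z, x ≠ 0 → y ≠ 0 → x ≠ y → f x y z = 0 := fun x y z hx hy hxy =>
    hout ![x, y, z] hx hy hxy
  have hsmul : ∀ t x y z, t ≠ 0 → f (t * x) (t * y) (t * z) = f x y z := by
    intro t x y z ht
    change val c _ = val c (∑ j, (![x, y, z] : Fin 3 → F) j • b j)
    rw [← val_smul c ht (∑ j, (![x, y, z] : Fin 3 → F) j • b j)]
    simp only [Fin.sum_univ_three, Matrix.cons_val_zero, Matrix.cons_val_one, Matrix.cons_val,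
      smul_add, smul_smul]
  have hfk : ∀ a b', f 0 1 a + f 1 0 b' + f 1 1 (a + b') = k := by
    intro s t
    have hu : ∑ j, (![0, 1, s] : Fin 3 → F) j • b j ≠ 0 := fun h => by
      have := congrFun (eq_zero_of_sum_smul_eq_zero hb h) 1
      simp at this
    have hv : ∑ j, (![1, 0, t] : Fin 3 → F) j • b j ∉
        span F {∑ j, (![0, 1, s] : Fin 3 → F) j • b j} := by
      intro h
      obtain ⟨z, hz⟩ := mem_span_singleton.mp h
      have := congrFun (eq_of_sum_smul_eq hb (x := ![0, z, z * s]) (y := ![1, 0, t]) (by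
        rw [← hz]
        simp only [Fin.sum_univ_three, Matrix.cons_val_zero, Matrix.cons_val_one, Matrix.cons_val]
        module)) 0
      simp at this
    have h := hk _ _ hu hv
    have hy : ∀ y : F, val c (∑ j, (![1, 0, t] : Fin 3 → F) j • b j
        + y • ∑ j, (![0, 1, s] : Fin 3 → F) j • b j) = f 1 y (t + y * s) := by
      intro y
      simp only [f, Fin.sum_univ_three, Matrix.cons_val_zero, Matrix.cons_val_one, Matrix.cons_val]
      congr 1
      module
    simp only [hy] at h
    rw [Fintype.sum_eq_add (0 : F) 1 zero_ne_one
      (fun y hy => hout' _ _ _ one_ne_zero hy.1 hy.2.symm)] at h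
    rw [← h]
    simp only [zero_mul, add_zero, one_mul, add_comm s t]
    exact add_assoc _ _ _
  have hok : f 0 0 1 = k := by
    obtain ⟨t, ht⟩ : ∃ t : F, t ∉ ({0, 1} : Finset F) := by
      by_contra! h
      have := Finset.card_le_card (fun x _ => h x : (Finset.univ : Finset F) ⊆ {0, 1})
      rw [Finset.card_univ] at this
      have := Finset.card_le_two (a := (0 : F)) (b := 1)
      omega
    simp only [Finset.mem_insert, Finset.mem_singleton, not_or] at ht
    have h := hk (b 2) ((1 : F) • b 0 + t • b 1) (hb.ne_zero 2)
      (smul_add_smul_notMem hb (Or.inl one_ne_zero))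
    have hy : ∀ y : F, val c ((1 : F) • b 0 + t • b 1 + y • b 2) = f 1 t y := by
      intro y
      simp only [f, Fin.sum_univ_three, Matrix.cons_val_zero, Matrix.cons_val_one, Matrix.cons_val]
    simp only [hy, hout' _ _ _ one_ne_zero ht.1 (Ne.symm ht.2), Finset.sum_const_zero,
      add_zero] at h
    rw [← h]
    simp [f, Fin.sum_univ_three]
  let φ : F →+ ZMod p :=
    { toFun := fun t => f 0 1 t - f 0 1 0
      map_zero' := sub_self _
      map_add' := fun s t => by
        have h1 := hfk s t
        have h2 := hfk (s + t) 0
        have h3 := hfk 0 t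
        have h4 := hfk t 0
        rw [add_zero] at h2 h4
        rw [zero_add] at h3
        linear_combination h2 - h1 + h3 - h4 }
  have hφ : ∀ t, φ t = f 0 1 t - f 0 1 0 := fun t => rfl
  refine ⟨φ, f 0 1 0, f 1 0 0, fun x hx => ?_⟩
  rw [hf]
  have e1 := hfk (x 2 / x 1) 0
  have e2 := hfk 0 (x 2 / x 0)
  have e3 := hfk 0 (x 2 / x 1)
  have e4 := hfk (x 2 / x 0) 0
  simp only [zero_add, add_zero] at e1 e2 e3 e4
  by_cases h0 : x 0 = 0 <;> by_cases h1 : x 1 = 0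
  · have h2 : x 2 ≠ 0 := fun h2 => hx (funext (forall_fin_three h0 h1 h2))
    have := hsmul (x 2) 0 0 1 h2
    simp only [mul_zero, mul_one] at this
    simp only [h0, h1, this, hok, ne_eq, not_true_eq_false, and_false, if_true, if_false]
    ring
  · have := hsmul (x 1) 0 1 (x 2 / x 1) h1
    rw [mul_zero, mul_one, mul_div_cancel₀ _ h1] at this
    simp only [h0, h1, this, hφ, Ne.symm h1, ne_eq, not_false_eq_true, and_self, if_true, if_false]
    ring
  · have := hsmul (x 0) 1 0 (x 2 / x 0) h0
    rw [mul_zero, mul_one, mul_div_cancel₀ _ h0] at this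
    simp only [h0, h1, this, hφ, ne_eq, not_false_eq_true, and_self, if_true, if_false, false_and]
    linear_combination e2 - e4
  · by_cases h01 : x 0 = x 1
    · have := hsmul (x 0) 1 1 (x 2 / x 0) h0
      rw [mul_one, mul_div_cancel₀ _ h0] at this
      rw [← h01, this]
      simp only [h0, hφ, ne_eq, not_false_eq_true, and_self, if_true, if_false, false_and]
      linear_combination e4
    · rw [hout' _ _ _ h0 h1 h01]
      simp [h0, h1, h01]

end Frames

section Concurrent

open Submodule Module

variable {n p : ℕ} [Fintype F]

lemma card_eq_mul_card_fiber [Fact p.Prime] {φ : F →+ ZMod p} (hφ : φ ≠ 0) (a : ZMod p) :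
    Fintype.card F = p * (Finset.univ.filter fun t => φ t = a).card := by
  have hsurj : ∀ y, y ∈ Set.range φ := by
    obtain ⟨t, ht⟩ : ∃ t, φ t ≠ 0 := by
      by_contra! h
      exact hφ (AddMonoidHom.ext h)
    intro y
    refine ⟨(y / φ t).val • t, ?_⟩
    rw [map_nsmul, nsmul_eq_mul, ZMod.natCast_zmod_val, div_mul_cancel₀ _ ht]
  have h := Finset.card_eq_sum_card_fiberwise (f := φ) (s := Finset.univ) (t := Finset.univ)
    (fun _ _ => Finset.mem_coe.mpr (Finset.mem_univ _))
  rw [Finset.card_univ] at h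
  rw [h, Finset.sum_congr rfl fun y _ =>
    AddMonoidHom.card_fiber_eq_of_mem_range φ (hsurj y) (hsurj a), Finset.sum_const,
    Finset.card_univ, ZMod.card, smul_eq_mul]

lemma card_eq_of_card_fiber_le [Fact p.Prime] [CharP F p] (hq : 17 ≤ Fintype.card F)
    {φ : F →+ ZMod p} (hφ : φ ≠ 0) {a : ZMod p}
    (h : (Finset.univ.filter fun t => φ t = a).card ≤ 4) : Fintype.card F = p := by
  obtain ⟨m, -, hm⟩ := FiniteField.card F p
  have hp := (Fact.out : p.Prime).two_le
  have h1 : Fintype.card F ≤ p * 4 := by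
    rw [card_eq_mul_card_fiber hφ a]
    exact Nat.mul_le_mul_left _ h
  rcases Nat.lt_or_ge (m : ℕ) 2 with hm2 | hm2
  · have : (m : ℕ) = 1 := by have := m.pos; omega
    rw [hm, this, pow_one]
  · have h2 : p ^ 2 ≤ Fintype.card F := hm ▸ Nat.pow_le_pow_right (by omega) hm2
    nlinarith

lemma typeOdd_of_coordinates [Fact p.Prime] [CharP F p] {c : Pt F n → ZMod p}
    {b : Fin 3 → Fin (n + 1) → F} {W : Submodule F (Fin (n + 1) → F)}
    (hcard : Fintype.card F = p) (hb : LinearIndependent F b) (hW : span F (Set.range b) = W)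
    {φ : F →+ ZMod p} (hφ : φ ≠ 0) (α β γ : ZMod p)
    (h : ∀ x : Fin 3 → F, x ≠ 0 → val c (∑ j, x j • b j) =
      (if x 0 = 0 ∧ x 1 ≠ 0 then φ (x 2 / x 1) else if x 1 = 0 ∧ x 0 ≠ 0 then φ (x 2 / x 0)
        else if x 0 = x 1 ∧ x 0 ≠ 0 then -φ (x 2 / x 0) else 0)
      + α * (if x 0 = 0 then 1 else 0) + β * (if x 1 = 0 then 1 else 0)
      + γ * (if x 0 = x 1 then 1 else 0)) : TypeOdd p c W := by
  let σ : ZMod p →+* F := ZMod.castHom (dvd_refl p) F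
  have hσφ : ∀ s, φ (σ s) = φ 1 * s := by
    intro s
    have h1 : σ s = s.val • (1 : F) := by
      rw [nsmul_eq_mul, mul_one, ← map_natCast σ, ZMod.natCast_zmod_val]
    rw [h1, map_nsmul, nsmul_eq_mul, ZMod.natCast_zmod_val, mul_comm]
  have hσ : Function.Surjective σ :=
    ((Fintype.bijective_iff_injective_and_card σ).mpr
      ⟨σ.injective, by rw [ZMod.card, hcard]⟩).surjective
  refine ⟨hcard, σ, b, hb, hW, LinearEquiv.refl _ _, φ 1, α, β, γ, ?_, fun Q => ?_⟩
  · intro h0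
    refine hφ (AddMonoidHom.ext fun t => ?_)
    obtain ⟨s, rfl⟩ := hσ t
    rw [hσφ, h0, zero_mul, AddMonoidHom.zero_apply]
  · have hmap : Projectivization.map (LinearEquiv.refl (ZMod p) (Fin 3 → ZMod p)).toLinearMap
        (LinearEquiv.refl (ZMod p) (Fin 3 → ZMod p)).injective Q = Q := by
      exact congrFun Projectivization.map_id Q
    have hx : (fun i => σ (Q.rep i)) ≠ 0 := fun hx =>
      Q.rep_nonzero (funext fun i => (map_eq_zero σ).mp (congrFun hx i))
    rw [planeEmbed, ← val_of_ne_zero c, h _ hx]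
    simp only [oddWord, hmap, oddBase, incVec, ptIn_iff_rep_mem, lineM1, lineM2, lineM3,
      LinearMap.mem_ker, LinearMap.proj_apply, LinearMap.sub_apply, sub_eq_zero,
      ← map_div₀, map_eq_zero, hσφ, σ.injective.eq_iff, ne_eq]
    congr 3
    split_ifs <;> ring

lemma typeStar_or_typeOdd_of_concurrent [Fact p.Prime] [CharP F p] (hq : 17 ≤ Fintype.card F)
    {c : Pt F n → ZMod p} {k : ZMod p} (hk : ∀ u v : Fin (n + 1) → F, u ≠ 0 → v ∉ span F {u} →
      val c u + ∑ x : F, val c (v + x • u) = k)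
    {W : Submodule F (Fin (n + 1) → F)} (hW : IsPlane W)
    (M : Fin 3 → Submodule F (Fin (n + 1) → F)) (hinj : M.Injective) (hM : ∀ i, IsLine (M i))
    (hMW : ∀ i, M i ≤ W) (hlong : ∀ i, Fintype.card F - 3 ≤ wtRes c (M i))
    (hout : ∀ u ∈ W, (∀ i, u ∉ M i) → val c u = 0)
    {o : Fin (n + 1) → F} (ho : o ≠ 0) (hoM : ∀ i, o ∈ M i) :
    TypeStar p c W ∨ TypeOdd p c W := by
  obtain ⟨b, hb, hbW, h0, h1, h2⟩ := exists_frame_of_concurrent hW M hinj hM hMW ho hoM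
  obtain ⟨φ, α, β, h⟩ := exists_addMonoidHom_of_concurrent (by omega) hk hb
    (fun x hx0 hx1 hx01 => hout _ (sum_smul_mem hbW x)
      (forall_fin_three (mt (h0 x).mp hx0) (mt (h1 x).mp hx1) (mt (h2 x).mp hx01)))
  have hsum : ∀ x y z : F, ∑ j, (![x, y, z] : Fin 3 → F) j • b j = (x • b 0 + y • b 1) + z • b 2 :=
    fun x y z => by
      simp only [Fin.sum_univ_three, Matrix.cons_val_zero, Matrix.cons_val_one, Matrix.cons_val]
  have hline : ∀ (i : Fin 3) (r s : F), r ≠ 0 ∨ s ≠ 0 →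
      (∀ z, ∑ j, (![r, s, z] : Fin 3 → F) j • b j ∈ M i) →
      b 2 ∈ M i → span F {b 2} ⊔ span F {r • b 0 + s • b 1} = M i := by
    intro i r s hrs hm hb2
    refine line_eq_of_mem (hM i) (hb.ne_zero 2) hb2 ?_ (smul_add_smul_notMem hb hrs)
    have := hm 0
    rwa [hsum, zero_smul, add_zero] at this
  have hb2 : ∀ i, b 2 ∈ M i := by
    have : b 2 = ∑ j, (![0, 0, 1] : Fin 3 → F) j • b j := by
      rw [hsum, zero_smul, zero_smul, zero_add, zero_add, one_smul]
    rw [this]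
    exact forall_fin_three ((h0 _).mpr rfl) ((h1 _).mpr rfl) ((h2 _).mpr rfl)
  have hM0 := hline 0 0 1 (Or.inr one_ne_zero) (fun z => (h0 _).mpr rfl) (hb2 0)
  have hM1 := hline 1 1 0 (Or.inl one_ne_zero) (fun z => (h1 _).mpr rfl) (hb2 1)
  have hM2 := hline 2 1 1 (Or.inl one_ne_zero) (fun z => (h2 _).mpr rfl) (hb2 2)
  by_cases hφ : φ = 0
  · left
    simp only [hφ, AddMonoidHom.zero_apply, neg_zero, ite_self, zero_add] at h
    have hcoef : ∀ (i : Fin 3) (r s : F) (a : ZMod p), r ≠ 0 ∨ s ≠ 0 →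
        span F {b 2} ⊔ span F {r • b 0 + s • b 1} = M i →
        (∀ z : F, val c (∑ j, (![r, s, z] : Fin 3 → F) j • b j) = a) → a ≠ 0 := by
      rintro i r s a hrs hL hv rfl
      have := wtRes_le_two_of_forall c (hb.ne_zero 2) (smul_add_smul_notMem hb hrs) hL
        (fun z _ => by rw [← hsum, hv])
      have := hlong i
      omega
    have hx : ∀ r s z : F, r ≠ 0 ∨ s ≠ 0 → (![r, s, z] : Fin 3 → F) ≠ 0 := by
      intro r s z hrs hx
      rcases hrs with hr | hs
      · exact hr (congrFun hx 0)
      · exact hs (congrFun hx 1)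
    refine typeStar_of_coordinates hb hbW ![0, 1, 1] ![1, 0, 1] ?_ ![α, β, k - α - β] ?_ ?_
    · intro i j hij
      fin_cases i <;> fin_cases j <;> first | exact absurd rfl hij | simp
    · refine forall_fin_three
        (hcoef 0 0 1 α (Or.inr one_ne_zero) hM0 fun z => ?_)
        (hcoef 1 1 0 β (Or.inl one_ne_zero) hM1 fun z => ?_)
        (hcoef 2 1 1 (k - α - β) (Or.inl one_ne_zero) hM2 fun z => ?_)
      · rw [h _ (hx _ _ _ (Or.inr one_ne_zero))]; simp
      · rw [h _ (hx _ _ _ (Or.inl one_ne_zero))]; simp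
      · rw [h _ (hx _ _ _ (Or.inl one_ne_zero))]; simp
    · intro x hx
      rw [h x hx, Fin.sum_univ_three]
      simp [eq_comm]
  · right
    refine typeOdd_of_coordinates (card_eq_of_card_fiber_le hq hφ (a := -α) ?_) hb hbW hφ α β _ h
    refine le_trans (Finset.card_le_card fun t ht => ?_)
      (card_val_eq_zero_le c (hb.ne_zero 2) (smul_add_smul_notMem hb (Or.inr one_ne_zero)) hM0
        (hlong 0))
    simp only [Finset.mem_filter, Finset.mem_univ, true_and] at ht ⊢
    rw [← hsum, h _ (fun hx => one_ne_zero (congrFun hx 1))]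
    simp [ht]

theorem typeT_of_three_secant_of_large [Fact p.Prime] [CharP F p] (hn : 3 ≤ n)
    (hq : 29 ≤ Fintype.card F) {c : Pt F n → ZMod p} (hc : c ∈ code F p n)
    (hD : suppCard c ≤ (Fintype.card F - 1) * (4 * (Fintype.card F - 4))
      * Fintype.card F ^ (n - 2))
    {W l : Submodule F (Fin (n + 1) → F)} (hW : IsPlane W) (hl : IsLine l) (hlW : l ≤ W)
    (hl3 : wtRes c l = 3) :
    TypeT p (Fintype.card F) c W := by
  obtain ⟨k, hk⟩ := exists_line_sum hc
  obtain ⟨M, hinj, hM, hMW, hlong, hcov, -⟩ := exists_long_lines hq hc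
    (fun L hL => wtRes_line_dichotomy hn hq hc hD hL) hW hl hlW hl3
    (wtRes_lt_of_three_secant hn hq hc hD hW hl hlW hl3)
  have hout : ∀ u ∈ W, (∀ i, u ∉ M i) → val c u = 0 := by
    intro u hu hi
    by_contra h0
    obtain ⟨i, hiM⟩ := hcov u hu h0
    exact hi i hiM
  by_cases hconc : ∃ o, o ≠ 0 ∧ ∀ i, o ∈ M i
  · obtain ⟨o, ho, hoM⟩ := hconc
    rcases typeStar_or_typeOdd_of_concurrent (by omega) hk hW M hinj hM hMW hlong hout ho hoM
      with h | h
    · exact ⟨hW, .Tstar, h⟩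
    · exact ⟨hW, .Todd, h⟩
  · exact ⟨hW, .Ttri, typeTri_of_support hk hW M hinj hM hMW
      (fun i => le_trans (by omega) (hlong i)) hout hconc⟩

end Concurrent

section SmallFields

open Submodule Module

variable {n p : ℕ}

lemma exists_frame {l W : Submodule F (Fin (n + 1) → F)} (hl : IsLine l) (hW : IsPlane W)
    (hlW : l ≤ W) : ∃ b : Fin 3 → Fin (n + 1) → F, LinearIndependent F b ∧
      span F (Set.range b) = W ∧ ∀ x : Fin 3 → F, ∑ j, x j • b j ∈ l ↔ x 0 = 0 := by
  obtain ⟨u, hul, hu⟩ : ∃ u ∈ l, u ≠ 0 := by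
    by_contra! h0
    rw [IsLine, (Submodule.eq_bot_iff _).mpr h0, finrank_bot] at hl
    omega
  obtain ⟨v, hvl, hvu, -⟩ := exists_line_eq hl hu hul
  obtain ⟨w, hwW, hwl, -⟩ := exists_plane_eq hl hW hlW
  have hsum : ∀ x : Fin 3 → F, ∑ j, x j • (![w, v, u] : Fin 3 → Fin (n + 1) → F) j
      = x 0 • w + (x 1 • v + x 2 • u) := by
    intro x
    simp [Fin.sum_univ_three, add_assoc]
  have hmem : ∀ x : Fin 3 → F, ∑ j, x j • (![w, v, u] : Fin 3 → Fin (n + 1) → F) j ∈ l ↔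
      x 0 = 0 := by
    intro x
    rw [hsum, l.add_mem_iff_left (add_mem (l.smul_mem _ hvl) (l.smul_mem _ hul))]
    refine ⟨fun h => ?_, fun h => by rw [h, zero_smul]; exact zero_mem _⟩
    by_contra ht
    exact hwl ((l.smul_mem_iff ht).mp h)
  have hb : LinearIndependent F (![w, v, u] : Fin 3 → Fin (n + 1) → F) := by
    rw [Fintype.linearIndependent_iff]
    intro x hx
    have hx0 := (hmem x).mp (by rw [hx]; exact zero_mem _)
    rw [hsum, hx0, zero_smul, zero_add] at hx
    have hx1 : x 1 = 0 := by
      by_contra h1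
      refine hvu (((span F {u}).smul_mem_iff h1).mp ?_)
      rw [eq_neg_of_add_eq_zero_left hx, neg_mem_iff]
      exact smul_mem _ _ (mem_span_singleton_self u)
    rw [hx1, zero_smul, zero_add] at hx
    exact forall_fin_three hx0 hx1 ((smul_eq_zero.mp hx).resolve_right hu)
  refine ⟨_, hb, Submodule.eq_of_le_of_finrank_eq ?_ ?_, hmem⟩
  · rw [span_le]
    rintro _ ⟨i, rfl⟩
    exact forall_fin_three (P := fun i => (![w, v, u] : Fin 3 → Fin (n + 1) → F) i ∈ W)
      hwW (hlW hvl) (hlW hul) i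
  · rw [finrank_span_eq_card hb, hW, Fintype.card_fin]

variable {b : Fin 3 → Fin (n + 1) → F} {W : Submodule F (Fin (n + 1) → F)}

lemma sup_line_eq (hb : LinearIndependent F b) (hW : span F (Set.range b) = W) :
    b 0 ∉ span F {b 2} ⊔ span F {(0 : F) • b 0 + (1 : F) • b 1} ∧
      span F {b 2} ⊔ span F {(0 : F) • b 0 + (1 : F) • b 1} ⊔ span F {b 0} = W := by
  have h0 : b 0 ∉ span F {b 2} ⊔ span F {(0 : F) • b 0 + (1 : F) • b 1} := by
    have h := sum_smul_mem_line_iff hb (r := 0) (s := 1) (Or.inr one_ne_zero) ![1, 0, 0]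
    simp only [Fin.sum_univ_three, Matrix.cons_val_zero, Matrix.cons_val_one, Matrix.cons_val,
      one_smul, zero_smul, add_zero, mul_one, mul_zero, one_ne_zero, iff_false] at h
    simpa using h
  refine ⟨h0, sup_span_singleton_eq (line_le hW _ _) (hW ▸ subset_span (Set.mem_range_self 0)) h0 ?_⟩
  rw [isLine_span_pair (hb.ne_zero 2) (smul_add_smul_notMem hb (Or.inr one_ne_zero)), ← hW,
    finrank_span_eq_card hb, Fintype.card_fin]

variable [Fintype F]

lemma twoLineComb_single_of_coordinates {c : Pt F n → ZMod p} (hb : LinearIndependent F b)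
    (hW : span F (Set.range b) = W) {a : ZMod p} (ha : a ≠ 0)
    (h : ∀ x : Fin 3 → F, x ≠ 0 → val c (∑ j, x j • b j) = if x 0 = 0 then a else 0) :
    TwoLineComb p c W ∧ wtRes c W = Fintype.card F + 1 := by
  have hnt : (0 : F) ≠ 0 ∨ (1 : F) ≠ 0 := Or.inr one_ne_zero
  refine ⟨twoLineComb_of_coordinates hb hW ![0, 0] ![1, 1] (by simp) ![a, 0]
    (fun x hx => by simp [h x hx]), ?_⟩
  obtain ⟨h0, hsup⟩ := sup_line_eq hb hW
  have hLW := line_le hW 0 1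
  rw [← hsup, wtRes_sup c h0, wtRes_line_of_forall c
    (isLine_span_pair (hb.ne_zero 2) (smul_add_smul_notMem hb hnt))]
  · rw [Nat.add_eq_left, cnt, Finset.card_eq_zero, Finset.filter_eq_empty_iff]
    rintro u - ⟨hu, hcu⟩
    obtain ⟨x, rfl⟩ := exists_eq_sum_smul hW (hLW hu)
    rw [sum_smul_mem_line_iff hb hnt] at hu
    have hx0 : x 0 = 0 := by simpa using hu
    refine hcu ?_
    have : b 0 + ∑ j, x j • b j = ∑ j, (![1, x 1, x 2] : Fin 3 → F) j • b j := by
      simp [Fin.sum_univ_three, hx0, add_assoc]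
    rw [this, h _ (fun hx => one_ne_zero (congrFun hx 0))]
    simp
  · intro u hu hu0
    obtain ⟨x, rfl⟩ := exists_eq_sum_smul hW (hLW hu)
    rw [sum_smul_mem_line_iff hb hnt] at hu
    have hx0 : x 0 = 0 := by simpa using hu
    rw [h x (by rintro rfl; simp at hu0), if_pos hx0]
    exact ha

lemma twoLineComb_sub_of_coordinates {c : Pt F n → ZMod p} (hb : LinearIndependent F b)
    (hW : span F (Set.range b) = W) {a : ZMod p} (ha : a ≠ 0)
    (h : ∀ x : Fin 3 → F, x ≠ 0 → val c (∑ j, x j • b j) =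
      (if x 0 = 0 then a else 0) - if x 1 = 0 then a else 0) :
    TwoLineComb p c W ∧ wtRes c W = 2 * Fintype.card F := by
  have hnt : (0 : F) ≠ 0 ∨ (1 : F) ≠ 0 := Or.inr one_ne_zero
  have hsum : ∀ x y z : F, ∑ j, (![x, y, z] : Fin 3 → F) j • b j = x • b 0 + y • b 1 + z • b 2 :=
    fun x y z => by simp [Fin.sum_univ_three]
  refine ⟨twoLineComb_of_coordinates hb hW ![0, 1] ![1, 0]
    (Fin.forall_fin_two.mpr ⟨by simp, by simp⟩) ![a, -a]
    (fun x hx => by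
      rw [h x hx, Fin.sum_univ_two]
      by_cases h1 : x 1 = 0 <;> simp [h1, @eq_comm F 0, sub_eq_add_neg]), ?_⟩
  obtain ⟨h0, hsup⟩ := sup_line_eq hb hW
  have hns := smul_add_smul_notMem hb hnt
  have hb2 : val c (b 2) = 0 := by
    have h1 := h ![0, 0, 1] (fun hx => one_ne_zero (congrFun hx 2))
    rw [hsum] at h1
    simpa using h1
  have hx : ∀ y z : F, val c (b 0 + y • ((0 : F) • b 0 + (1 : F) • b 1) + z • b 2)
      = -if y = 0 then a else 0 := by
    intro y z
    have h1 := h ![1, y, z] (fun hx => one_ne_zero (congrFun hx 0))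
    rw [hsum] at h1
    by_cases hy : y = 0 <;> simpa [hy] using h1
  have hy : ∀ z : F, val c ((0 : F) • b 0 + (1 : F) • b 1 + z • b 2) = a := by
    intro z
    have h1 := h ![0, 1, z] (fun hx => one_ne_zero (congrFun hx 1))
    rw [hsum] at h1
    simpa using h1
  rw [← hsup, wtRes_sup c h0, wtRes_span_pair c (hb.ne_zero 2) hns, cnt_sup c hns]
  simp only [cnt_span_singleton c (hb.ne_zero 2), hb2, hx, hy]
  rw [Fintype.sum_eq_single (0 : F) (fun y hy => by simp [hy])]
  simp [ha, two_mul]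

lemma typeT_of_card_eq_two [CharP F 2] (hF : Fintype.card F = 2)
    {c : Pt F n → ZMod 2} (hc : c ∈ code F 2 n) {l : Submodule F (Fin (n + 1) → F)}
    (hW : IsPlane W) (hl : IsLine l) (hlW : l ≤ W) (hl3 : wtRes c l = 3) :
    TypeT 2 (Fintype.card F) c W := by
  obtain ⟨k, hk⟩ := exists_line_sum hc
  obtain ⟨b, hb, hbW, hbl⟩ := exists_frame hl hW hlW
  have h01 : ∀ x : F, x = 0 ∨ x = 1 := by
    intro x
    by_contra! hx
    have h1 := Finset.card_le_univ ({0, 1, x} : Finset F)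
    rw [hF, Finset.card_eq_three.mpr ⟨0, 1, x, zero_ne_one, hx.1.symm, hx.2.symm, rfl⟩] at h1
    omega
  have hF2 : ∀ f : F → ZMod 2, ∑ x, f x = f 0 + f 1 := fun f =>
    Fintype.sum_eq_add 0 1 zero_ne_one fun x hx => absurd (h01 x) (by tauto)
  have hone : ∀ u ∈ l, u ≠ 0 → val c u = 1 := by
    intro u hu hu0
    have : ∀ s : ZMod 2, s ≠ 0 → s = 1 := by decide
    refine this _ fun hcu => ?_
    have := wtRes_line_le c hl hu0 hu hcu
    omega
  have hk1 : k = 1 := by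
    have hl2 : ∀ y z : F, y • b 1 + z • b 2 ∈ l := by
      intro y z
      have := (hbl ![0, y, z]).mpr rfl
      simpa [Fin.sum_univ_three] using this
    have hns : b 1 ∉ span F {b 2} := by
      simpa using smul_add_smul_notMem hb (r := 0) (s := 1) (Or.inr one_ne_zero)
    have h1 := hk _ _ (hb.ne_zero 2) hns
    rw [hF2, hone (b 2) (by simpa using hl2 0 1) (hb.ne_zero 2),
      hone _ (by simpa using hl2 1 0) (notMem_span_singleton_add hns 0),
      hone _ (by simpa using hl2 1 1) (notMem_span_singleton_add hns 1)] at h1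
    exact h1.symm
  have hval : ∀ x : Fin 3 → F, x ≠ 0 → val c (∑ j, x j • b j) =
      if x 0 = 0 then 1 else val c (b 0) := by
    intro x hx
    split_ifs with h0
    · exact hone _ ((hbl x).mpr h0) fun h => hx (eq_zero_of_sum_smul_eq_zero hb h)
    · have h1 : x 0 = 1 := (h01 _).resolve_left h0
      have h2 : ∑ j, x j • b j = b 0 + (1 : F) • ∑ j, (![0, x 1, x 2] : Fin 3 → F) j • b j := by
        simp [Fin.sum_univ_three, h1, add_assoc]
      have h3 : ∑ j, (![0, x 1, x 2] : Fin 3 → F) j • b j ∈ l := (hbl _).mpr rfl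
      have h4 : b 0 ∉ l := by
        have := hbl ![1, 0, 0]
        simpa [Fin.sum_univ_three] using this
      rw [h2]
      by_cases h5 : ∑ j, (![0, x 1, x 2] : Fin 3 → F) j • b j = 0
      · rw [h5, smul_zero, add_zero]
      · have h6 := hk _ (b 0) h5 fun h =>
          h4 ((span_singleton_le_iff_mem _ _).mpr h3 h)
        rw [hF2, hone _ h3 h5, zero_smul, add_zero, hk1, add_eq_left] at h6
        exact (CharTwo.add_eq_zero.mp h6).symm
  have ht : ∀ s : ZMod 2, s = 0 ∨ s = 1 := by decide
  rcases ht (val c (b 0)) with h | h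
  · exact ⟨hW, .Tq1, twoLineComb_single_of_coordinates hb hbW one_ne_zero (by simpa [h] using hval)⟩
  · refine ⟨hW, .Tstar, typeStar_of_coordinates hb hbW ![0, 1, 1] ![1, 0, 1] ?_ ![1, 1, 1]
      (by intro i; fin_cases i <;> simp) ?_⟩
    · intro i j hij
      fin_cases i <;> fin_cases j <;> first | exact absurd rfl hij | simp
    · intro x hx
      rw [hval x hx, h, Fin.sum_univ_three]
      rcases h01 (x 0) with h0 | h0 <;> rcases h01 (x 1) with h1 | h1 <;> simp [h0, h1]
      decide

end SmallFields

section Ternary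

open Submodule Module

variable {n : ℕ}

/-- Up to a permutation of the coordinates, a diagonal form over `F_3` is of one of four shapes. -/
lemma exists_perm_diagonal (t : ZMod 3) (w : Fin 3 → ZMod 3) : ∃ e : Equiv.Perm (Fin 3),
    (w (e 0) ≠ 0 ∧ w (e 1) ≠ 0 ∧ w (e 2) ≠ 0) ∨
    (w (e 0) ≠ 0 ∧ w (e 1) = w (e 0) ∧ w (e 2) = 0) ∨
    (w (e 0) ≠ 0 ∧ w (e 1) = -w (e 0) ∧ w (e 2) = 0 ∧ (t = 0 ∨ w (e 0) = -t)) ∨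
    (w (e 1) = 0 ∧ w (e 2) = 0) := by
  revert t w
  decide +kernel

/-- A ternary quadratic polynomial which is sufficiently nondegenerate has few zeros. -/
lemma thirteen_le_card_ne_zero {w0 w1 w2 : ZMod 3}
    (hw : (w0 ≠ 0 ∧ w1 ≠ 0 ∧ w2 ≠ 0) ∨ (w0 ≠ 0 ∧ w1 = w0 ∧ w2 = 0)) (t α0 α1 α2 : ZMod 3) :
    13 ≤ (Finset.univ.filter fun y : ZMod 3 × ZMod 3 × ZMod 3 =>
      t + (w0 * y.1 ^ 2 + y.1 * α0) + (w1 * y.2.1 ^ 2 + y.2.1 * α1)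
        + (w2 * y.2.2 ^ 2 + y.2.2 * α2) ≠ 0).card := by
  have key : ∀ t w0 w1 w2 α : ZMod 3,
      (w0 ≠ 0 ∧ w1 ≠ 0 ∧ w2 ≠ 0 ∧ α = 0) ∨ (w0 ≠ 0 ∧ w1 = w0 ∧ w2 = 0) →
      13 ≤ (Finset.univ.filter fun y : ZMod 3 × ZMod 3 × ZMod 3 =>
        t + w0 * y.1 ^ 2 + w1 * y.2.1 ^ 2 + w2 * y.2.2 ^ 2 + y.2.2 * α ≠ 0).card := by
    decide +kernel
  have hsq : ∀ w α y : ZMod 3, w ≠ 0 → w * y ^ 2 + y * α = w * (y - α * w) ^ 2 - w * α ^ 2 := by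
    decide
  obtain ⟨α, hα, hw2⟩ : ∃ α, ((w0 ≠ 0 ∧ w1 ≠ 0 ∧ w2 ≠ 0 ∧ α = 0) ∨
      (w0 ≠ 0 ∧ w1 = w0 ∧ w2 = 0)) ∧ ∀ y : ZMod 3, w2 * y ^ 2 + y * α2 =
      w2 * (y - α2 * w2) ^ 2 - w2 * α2 ^ 2 + (y - α2 * w2) * α := by
    rcases hw with ⟨h0, h1, h2⟩ | ⟨h0, h1, h2⟩
    · exact ⟨0, Or.inl ⟨h0, h1, h2, rfl⟩, fun y => by rw [hsq _ _ _ h2]; ring⟩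
    · exact ⟨α2, Or.inr ⟨h0, h1, h2⟩, fun y => by rw [h2]; ring⟩
  have h0 : w0 ≠ 0 := by tauto
  have h1 : w1 ≠ 0 := by rcases hw with h | h <;> [exact h.2.1; exact h.2.1 ▸ h.1]
  refine (key (t - w0 * α0 ^ 2 - w1 * α1 ^ 2 - w2 * α2 ^ 2) w0 w1 w2 α hα).trans_eq ?_
  refine Finset.card_equiv (Equiv.addRight (α0 * w0, α1 * w1, α2 * w2)) fun y => ?_
  simp only [Finset.mem_filter, Finset.mem_univ, true_and, Equiv.coe_addRight, Prod.fst_add,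
    Prod.snd_add, hsq _ _ _ h0, hsq _ _ _ h1, hw2, add_sub_cancel_right]
  ring_nf

variable {b : Fin 3 → Fin (n + 1) → F} {W : Submodule F (Fin (n + 1) → F)}

lemma typeStar_of_zmod_coordinates {p : ℕ} (σ : ZMod p ≃+* F) {c : Pt F n → ZMod p}
    (hb : LinearIndependent F b) (hW : span F (Set.range b) = W) (r s : Fin 3 → ZMod p)
    (hrs : ∀ i j, i ≠ j → r i * s j ≠ r j * s i) (a : Fin 3 → ZMod p) (ha : ∀ i, a i ≠ 0)
    (h : ∀ x : Fin 3 → F, x ≠ 0 → val c (∑ j, x j • b j) =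
      ∑ i, a i * if σ.symm (x 0) * s i = σ.symm (x 1) * r i then 1 else 0) : TypeStar p c W := by
  refine typeStar_of_coordinates hb hW (σ ∘ r) (σ ∘ s) ?_ a ha fun x hx => ?_
  · intro i j hij
    simp only [Function.comp_apply, ← map_mul]
    exact σ.injective.ne (hrs i j hij)
  · rw [h x hx]
    refine Finset.sum_congr rfl fun i _ => ?_
    congr 1
    refine if_congr ?_ rfl rfl
    rw [← σ.injective.eq_iff, map_mul, map_mul, σ.apply_symm_apply, σ.apply_symm_apply]
    rfl

lemma exists_frame_diagonal (h2 : (2 : F) ≠ 0) (Q : QuadraticForm F (Fin (n + 1) → F))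
    (hW : IsPlane W) : ∃ (b : Fin 3 → Fin (n + 1) → F) (w : Fin 3 → F),
      LinearIndependent F b ∧ span F (Set.range b) = W ∧
      ∀ x : Fin 3 → F, Q (∑ j, x j • b j) = ∑ j, w j * x j ^ 2 := by
  have := invertibleOfNonzero h2
  have h := QuadraticForm.equivalent_weightedSumSquares (Q.comp W.subtype)
  rw [hW] at h
  obtain ⟨w, ⟨e⟩⟩ := h
  let B := Basis.ofEquivFun e.toLinearEquiv
  refine ⟨fun j => (B j : Fin (n + 1) → F), w,
    B.linearIndependent.map' W.subtype W.ker_subtype, ?_, fun x => ?_⟩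
  · have : Set.range (fun j => (B j : Fin (n + 1) → F)) = W.subtype '' Set.range B := by
      rw [← Set.range_comp]
      rfl
    rw [this, ← map_span, B.span_eq, Submodule.map_top, range_subtype]
  · have h1 : ∑ j, x j • (B j : Fin (n + 1) → F) = W.subtype (B.equivFun.symm x) := by
      rw [B.equivFun_symm_apply, map_sum]
      rfl
    have h2 := e.map_app (B.equivFun.symm x)
    rw [h1, ← QuadraticMap.comp_apply, ← h2, QuadraticMap.weightedSumSquares_apply]
    have h3 : e (B.equivFun.symm x) = x := by
      simp only [B, Basis.equivFun_ofEquivFun]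
      exact e.toLinearEquiv.apply_symm_apply x
    rw [h3]
    exact Finset.sum_congr rfl fun j _ => by rw [smul_eq_mul, sq]

variable [Fintype F]

/-- A ternary code word is the sum of a constant and a quadratic form. -/
lemma exists_quadraticForm (hF : Fintype.card F = 3) (σ : ZMod 3 →+* F) {c : Pt F n → ZMod 3}
    (hc : c ∈ code F 3 n) : ∃ (a : F) (Q : QuadraticForm F (Fin (n + 1) → F)),
      ∀ v, v ≠ 0 → σ (val c v) = a + Q v := by
  refine code_induction (Q := fun c => ∃ (a : F) (Q : QuadraticForm F (Fin (n + 1) → F)),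
    ∀ v, v ≠ 0 → σ (val c v) = a + Q v) ?_ ?_ ?_ ?_ hc
  · exact ⟨0, 0, fun v _ => by simp [val_zero_word]⟩
  · rintro c d ⟨a, Q, h⟩ ⟨a', Q', h'⟩
    refine ⟨a + a', Q + Q', fun v hv => ?_⟩
    rw [val_add, map_add, h v hv, h' v hv, add_apply]
    ring
  · rintro s c ⟨a, Q, h⟩
    refine ⟨σ s * a, σ s • Q, fun v hv => ?_⟩
    rw [val_const_smul, map_mul, h v hv, smul_apply, smul_eq_mul, mul_add]
  · intro φ _
    refine ⟨1, -QuadraticMap.linMulLin φ φ, fun v hv => ?_⟩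
    rw [val_incVec _ hv, neg_apply, QuadraticMap.linMulLin_apply,
      LinearMap.mem_ker]
    split_ifs with h
    · simp [h]
    · have := FiniteField.pow_card_sub_one_eq_one _ h
      rw [hF] at this
      rw [map_zero, ← sq, this]
      ring

lemma not_forall_thirteen_le (hn : 3 ≤ n) (hF : Fintype.card F = 3) {c : Pt F n → ZMod 3}
    (hwt : suppCard c ≤ 4 * 3 ^ (n - 1)) (f : (Fin (n + 1) → F) → F)
    (hf : ∀ v, v ≠ 0 → f v ≠ 0 → val c v ≠ 0) {ι : Type} [Fintype ι] (hι : Fintype.card ι = 27)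
    (s : ι → Fin (n + 1) → F) :
    ¬ ∀ v, 13 ≤ (Finset.univ.filter fun y => f (v + s y) ≠ 0).card := by
  intro h
  have hD : (Finset.univ.filter fun v => f v ≠ 0).card ≤ suppCard c + 1 := by
    refine le_trans (Finset.card_le_card fun v hv => ?_) (Finset.card_insert_le 0
      (Finset.univ.filter fun v : Fin (n + 1) → F => val c v ≠ 0))
    simp only [Finset.mem_filter, Finset.mem_univ, true_and, Finset.mem_insert] at hv ⊢
    by_cases h0 : v = 0
    · exact Or.inl h0
    · exact Or.inr (hf v h0 hv)
  have hsum : ∑ v, (Finset.univ.filter fun y => f (v + s y) ≠ 0).card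
      = 27 * (Finset.univ.filter fun v => f v ≠ 0).card := by
    simp only [Finset.card_filter]
    rw [Finset.sum_comm, ← hι, ← smul_eq_mul, ← Finset.card_univ, ← Finset.sum_const]
    exact Finset.sum_congr rfl fun y _ =>
      Equiv.sum_comp (Equiv.addRight (s y)) fun v => if f v ≠ 0 then 1 else 0
  have hle := Finset.card_nsmul_le_sum Finset.univ
    (fun v => (Finset.univ.filter fun y => f (v + s y) ≠ 0).card) 13 fun v _ => h v
  rw [hsum, Finset.card_univ, Fintype.card_fun, Fintype.card_fin, hF, smul_eq_mul] at hle
  obtain ⟨m, rfl⟩ := Nat.exists_eq_add_of_le hn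
  have h1 : 3 ^ (3 + m + 1) = 81 * 3 ^ m := by ring
  have h2 : 3 ^ (3 + m - 1) = 9 * 3 ^ m := by
    rw [show 3 + m - 1 = 2 + m by omega]
    ring
  have h3 : 0 < 3 ^ m := by positivity
  rw [h1] at hle
  rw [h2] at hwt
  omega

lemma not_nondegenerate (hn : 3 ≤ n) (hF : Fintype.card F = 3) (σ : ZMod 3 ≃+* F)
    {c : Pt F n → ZMod 3} (hwt : suppCard c ≤ 4 * 3 ^ (n - 1)) {a : F}
    {Q : QuadraticForm F (Fin (n + 1) → F)} (hQ : ∀ v, v ≠ 0 → σ (val c v) = a + Q v)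
    {w : Fin 3 → ZMod 3} (hb : ∀ x : Fin 3 → F, Q (∑ j, x j • b j) = ∑ j, σ (w j) * x j ^ 2) :
    ¬ ((w 0 ≠ 0 ∧ w 1 ≠ 0 ∧ w 2 ≠ 0) ∨ (w 0 ≠ 0 ∧ w 1 = w 0 ∧ w 2 = 0)) := by
  intro hw
  refine not_forall_thirteen_le hn hF hwt (fun v => a + Q v)
    (fun v hv h0 h1 => h0 (by rw [← hQ v hv, h1, map_zero])) (ι := ZMod 3 × ZMod 3 × ZMod 3)
    (by simp [ZMod.card])
    (fun y => ∑ j, (![σ y.1, σ y.2.1, σ y.2.2] : Fin 3 → F) j • b j) fun v => ?_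
  refine (thirteen_le_card_ne_zero hw (σ.symm (a + Q v)) (σ.symm (Q.polarBilin v (b 0)))
    (σ.symm (Q.polarBilin v (b 1))) (σ.symm (Q.polarBilin v (b 2)))).trans_eq ?_
  congr 1
  refine Finset.filter_congr fun y _ => not_congr ?_
  have key : ∀ x : Fin 3 → F, Q (v + ∑ j, x j • b j) =
      Q v + ∑ j, σ (w j) * x j ^ 2 + ∑ j, x j * Q.polarBilin v (b j) := fun x => by
    rw [QuadraticMap.map_add Q v, hb, ← QuadraticMap.polarBilin_apply_apply, map_sum]
    simp only [map_smul, smul_eq_mul]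
  rw [← map_eq_zero σ, key]
  simp only [map_add σ, map_mul σ, map_pow σ, RingEquiv.apply_symm_apply, Fin.sum_univ_three,
    Matrix.cons_val_zero, Matrix.cons_val_one, Matrix.cons_val]
  ring_nf

lemma typeT_of_card_eq_three [CharP F 3] (hn : 3 ≤ n) (hF : Fintype.card F = 3)
    {c : Pt F n → ZMod 3} (hc : c ∈ code F 3 n) (hwt : suppCard c ≤ 4 * 3 ^ (n - 1))
    {l : Submodule F (Fin (n + 1) → F)} (hW : IsPlane W) (hl : IsLine l) (hlW : l ≤ W)
    (hl3 : wtRes c l = 3) : TypeT 3 (Fintype.card F) c W := by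
  let σ : ZMod 3 ≃+* F := ZMod.ringEquiv F hF
  obtain ⟨a, Q, hQ⟩ := exists_quadraticForm hF (σ : ZMod 3 →+* F) hc
  have h2 : (2 : F) ≠ 0 := by
    rw [← map_ofNat σ 2]
    exact (map_ne_zero σ).mpr (by decide)
  obtain ⟨b', w', hb', hbW', hw'⟩ := exists_frame_diagonal h2 Q hW
  obtain ⟨e, he⟩ := exists_perm_diagonal (σ.symm a) (σ.symm ∘ w')
  obtain ⟨b, hb, hbW, w, hw, he⟩ : ∃ b : Fin 3 → Fin (n + 1) → F, LinearIndependent F b ∧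
      span F (Set.range b) = W ∧ ∃ w : Fin 3 → ZMod 3,
      (∀ x : Fin 3 → F, Q (∑ j, x j • b j) = ∑ j, σ (w j) * x j ^ 2) ∧
      ((w 0 ≠ 0 ∧ w 1 ≠ 0 ∧ w 2 ≠ 0) ∨ (w 0 ≠ 0 ∧ w 1 = w 0 ∧ w 2 = 0) ∨
        (w 0 ≠ 0 ∧ w 1 = -w 0 ∧ w 2 = 0 ∧ (σ.symm a = 0 ∨ w 0 = -σ.symm a)) ∨
        (w 1 = 0 ∧ w 2 = 0)) := by
    refine ⟨b' ∘ e, hb'.comp _ e.injective, by rw [e.surjective.range_comp, hbW'],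
      σ.symm ∘ w' ∘ e, fun x => ?_, he⟩
    have h1 := hw' (x ∘ e.symm)
    rw [← Equiv.sum_comp e fun j => (x ∘ e.symm) j • b' j,
      ← Equiv.sum_comp e fun j => w' j * (x ∘ e.symm) j ^ 2] at h1
    simpa using h1
  have hnd := not_nondegenerate hn hF σ hwt hQ hw
  have hval : ∀ x : Fin 3 → F, x ≠ 0 → val c (∑ j, x j • b j) =
      σ.symm a + (w 0 * σ.symm (x 0) ^ 2 + w 1 * σ.symm (x 1) ^ 2 + w 2 * σ.symm (x 2) ^ 2) := by
    intro x hx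
    rw [← Fin.sum_univ_three fun j => w j * σ.symm (x j) ^ 2]
    apply σ.injective
    have h1 := hQ _ (fun h => hx (eq_zero_of_sum_smul_eq_zero hb h))
    rw [hw] at h1
    rw [map_add, map_sum, σ.apply_symm_apply]
    simpa using h1
  obtain ⟨x₁, hx₁, hc₁⟩ : ∃ x : Fin 3 → F, x ≠ 0 ∧ val c (∑ j, x j • b j) = 0 := by
    obtain ⟨u, hul, hu, hcu⟩ := exists_val_eq_zero c hl (by omega)
    obtain ⟨x, rfl⟩ := exists_eq_sum_smul hbW (hlW hul)
    exact ⟨x, by rintro rfl; simp at hu, hcu⟩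
  obtain ⟨x₂, hx₂, hc₂⟩ : ∃ x : Fin 3 → F, x ≠ 0 ∧ val c (∑ j, x j • b j) ≠ 0 := by
    by_contra! h0
    have h3 : ptsIn l ∩ supp c = ∅ := by
      refine Set.eq_empty_of_forall_notMem fun P hP => hP.2 ?_
      obtain ⟨x, hx⟩ := exists_eq_sum_smul hbW (hlW ((ptIn_iff_rep_mem _ _).mp hP.1))
      rw [← val_rep c P, hx]
      exact h0 x (by rintro rfl; exact P.rep_nonzero (by simpa using hx))
    rw [wtRes, h3, Set.ncard_empty] at hl3
    omega
  have hzero : ∀ x : F, x = 0 ↔ σ.symm x = 0 := fun x => (map_eq_zero σ.symm).symm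
  generalize σ.symm a = t at he hval
  rcases he with he | he | ⟨h0, h1, h2, ht⟩ | ⟨h1, h2⟩
  · exact absurd (Or.inl he) hnd
  · exact absurd (Or.inr he) hnd
  · simp only [h1, h2, zero_mul, add_zero] at hval
    by_cases ht0 : t = 0
    · refine ⟨hW, .T2q, twoLineComb_sub_of_coordinates hb hbW (a := -w 0) (neg_ne_zero.mpr h0)
        fun x hx => ?_⟩
      have key : ∀ w y0 y1 : ZMod 3, 0 + (w * y0 ^ 2 + -w * y1 ^ 2) =
        (if y0 = 0 then -w else 0) - if y1 = 0 then -w else 0 := by decide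
      rw [hval x hx, ht0, key]
      simp only [hzero]
    · have key : ∀ t y0 y1 : ZMod 3, t + (-t * y0 ^ 2 + - -t * y1 ^ 2) =
          ∑ i, (![t, t, -t] : Fin 3 → ZMod 3) i *
            if y0 * (![1, -1, 1] : Fin 3 → ZMod 3) i = y1 * (![1, 1, 0] : Fin 3 → ZMod 3) i
            then 1 else 0 := by decide
      refine ⟨hW, .Tstar, typeStar_of_zmod_coordinates σ hb hbW ![1, 1, 0] ![1, -1, 1] (by decide)
        ![t, t, -t] (forall_fin_three ht0 ht0 (neg_ne_zero.mpr ht0)) fun x hx => ?_⟩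
      rw [hval x hx, ht.resolve_left ht0, key]
  · simp only [h1, h2, zero_mul, add_zero] at hval
    have hcases : ∀ t w y z : ZMod 3, t + w * y ^ 2 = 0 → t + w * z ^ 2 ≠ 0 →
        w ≠ 0 ∧ (t = 0 ∨ w = -t) := by decide
    rw [hval x₁ hx₁] at hc₁
    rw [hval x₂ hx₂] at hc₂
    obtain ⟨h0, ht⟩ := hcases _ _ _ _ hc₁ hc₂
    by_cases ht0 : t = 0
    · have key : ∀ w y0 y1 : ZMod 3, 0 + w * y0 ^ 2 =
          ∑ i, (![w, w, w] : Fin 3 → ZMod 3) i *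
            if y0 * (![0, 1, -1] : Fin 3 → ZMod 3) i = y1 * (![1, 1, 1] : Fin 3 → ZMod 3) i
            then 1 else 0 := by decide
      refine ⟨hW, .Tstar, typeStar_of_zmod_coordinates σ hb hbW ![1, 1, 1] ![0, 1, -1] (by decide)
        ![w 0, w 0, w 0] (forall_fin_three h0 h0 h0) fun x hx => ?_⟩
      rw [hval x hx, ht0, key _ _ (σ.symm (x 1))]
    · have key : ∀ t y : ZMod 3, t + -t * y ^ 2 = if y = 0 then t else 0 := by decide
      refine ⟨hW, .Tq1, twoLineComb_single_of_coordinates hb hbW ht0 fun x hx => ?_⟩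
      rw [hval x hx, ht.resolve_left ht0, key]
      simp only [hzero]

end Ternary

section Bounds

variable {n q : ℕ}

lemma sub_one_mul_B_le (hn : 3 ≤ n) (hq : 4 ≤ q) (hq' : q < 29) :
    ((q : ℝ) - 1) * B n q ≤ (3 * q - 6) * (q : ℝ) ^ (n - 1) := by
  have h4 : (4 : ℝ) ≤ q := by exact_mod_cast hq
  have h28 : (q : ℝ) ≤ 28 := by exact_mod_cast Nat.le_of_lt_succ hq'
  have hpow : (q : ℝ) ^ (n - 1) = q * (q : ℝ) ^ (n - 2) := by
    rw [← pow_succ']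
    congr 1
    omega
  have hpos : (0 : ℝ) ≤ (q : ℝ) ^ (n - 2) := by positivity
  suffices h : ∃ β : ℝ, B n q = β * (q : ℝ) ^ (n - 2) ∧
      ((q : ℝ) - 1) * β ≤ (3 * q - 6) * q by
    obtain ⟨β, hB, hβ⟩ := h
    rw [hB, hpow, ← mul_assoc, ← mul_assoc]
    exact mul_le_mul_of_nonneg_right hβ hpos
  unfold B
  split_ifs with h1 h2 h3 h5
  · exact ⟨2 * q, by rw [hpow]; ring, by nlinarith⟩
  · have : (7 : ℝ) ≤ q := by exact_mod_cast (by omega : 7 ≤ q)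
    have hs : (9 / 2 : ℝ) ≤ √(6 * q) := Real.le_sqrt_of_sq_le (by linarith)
    exact ⟨_, rfl, by nlinarith⟩
  · obtain rfl : q = 19 := by omega
    have hs : (10 : ℝ) ≤ √(6 * (19 : ℕ)) := Real.le_sqrt_of_sq_le (by norm_num)
    refine ⟨_, rfl, ?_⟩
    norm_num at hs ⊢
    linarith
  · omega
  · have : (8 : ℝ) ≤ q := by exact_mod_cast (by omega : 8 ≤ q)
    have hs : 8 + ((q : ℝ) - 8) / 3 ≤ √(8 * q) := Real.le_sqrt_of_sq_le (by nlinarith)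
    refine ⟨_, rfl, ?_⟩
    have h6 : ((q : ℝ) - 1) * (4 * q - √(8 * q) - 33 / 2) ≤
        (q - 1) * (4 * q - (8 + ((q : ℝ) - 8) / 3) - 33 / 2) :=
      mul_le_mul_of_nonneg_left (by linarith) (by linarith)
    nlinarith

lemma B_le_of_le (hn : 3 ≤ n) (hq : 29 ≤ q) :
    B n q ≤ 4 * ((q : ℝ) - 4) * (q : ℝ) ^ (n - 2) := by
  have h29 : (29 : ℝ) ≤ q := by exact_mod_cast hq
  have hpow : (q : ℝ) ^ (n - 1) = q * (q : ℝ) ^ (n - 2) := by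
    rw [← pow_succ']
    congr 1
    omega
  have hpos : (0 : ℝ) ≤ (q : ℝ) ^ (n - 2) := by positivity
  unfold B
  split_ifs with h1 h2 h3 h5
  · rw [hpow, ← mul_assoc]
    exact mul_le_mul_of_nonneg_right (by linarith) hpos
  · omega
  · exact mul_le_mul_of_nonneg_right (by linarith [Real.sqrt_nonneg (6 * (q : ℝ))]) hpos
  · have hs : (5 : ℝ) ≤ √q := Real.le_sqrt_of_sq_le (by linarith)
    exact mul_le_mul_of_nonneg_right (by linarith) hpos
  · exact mul_le_mul_of_nonneg_right (by linarith [Real.sqrt_nonneg (8 * (q : ℝ))]) hpos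

lemma sub_one_mul_theta (hn : 3 ≤ n) :
    ((q : ℝ) - 1) * theta q ((n : ℤ) - 2) = (q : ℝ) ^ (n - 1) - 1 := by
  have h : ((n : ℤ) - 2).toNat + 1 = n - 1 := by omega
  rw [theta, if_neg (by omega), h]
  push_cast
  exact mul_geom_sum _ _

lemma lt_four_or_le_of_bounds (hn : 3 ≤ n) {w : ℕ}
    (hlow : (3 * q - 6) * theta q ((n : ℤ) - 2) + 3 ≤ w) (hup : (w : ℝ) ≤ B n q) :
    q < 4 ∨ 29 ≤ q := by
  by_contra! hq
  have h4 : (4 : ℝ) ≤ q := by exact_mod_cast hq.1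
  have h1 := sub_one_mul_B_le hn hq.1 hq.2
  have h2 := sub_one_mul_theta (q := q) hn
  have h3 : ((3 : ℝ) * q - 6) * theta q ((n : ℤ) - 2) + 3 ≤ B n q := by
    refine le_trans ?_ hup
    rw [← Nat.cast_le (α := ℝ), Nat.cast_add, Nat.cast_mul, Nat.cast_sub (by omega)] at hlow
    simpa using hlow
  have h5 := mul_le_mul_of_nonneg_left h3 (by linarith : (0 : ℝ) ≤ (q : ℝ) - 1)
  have h6 : ((q : ℝ) - 1) * ((3 * q - 6) * theta q ((n : ℤ) - 2) + 3) =
      (3 * q - 6) * ((q : ℝ) ^ (n - 1) - 1) + 3 * (q - 1) := by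
    rw [← h2]
    ring
  linarith

end Bounds

/-- Lemma 20 of the paper: for a code word of weight between
`(3q-6)θ_{n-2}+3` and `B_{n,q}`, every plane containing a `3`-secant is of type `𝒯`. -/
theorem statement9 [Fintype F] {p h q n : ℕ} [Fact p.Prime] (hh : 1 ≤ h) (hq : q = p ^ h)
    (hF : Fintype.card F = q) (hn : 3 ≤ n)
    (c : Pt F n → ZMod p) (hc : c ∈ code F p n)
    (hlow : (3 * q - 6) * theta q ((n : ℤ) - 2) + 3 ≤ wt c) (hwt : (wt c : ℝ) ≤ B n q) :
    ∀ W : Submodule F (Fin (n + 1) → F), IsPlane W →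
      (∃ l : Submodule F (Fin (n + 1) → F), l ≤ W ∧ secant c l 3) →
      TypeT p q c W := by
  rintro W hW ⟨l, hlW, hl, hl3⟩
  have hchar : CharP F p := charP_of_card_eq_prime_pow (hF.trans hq)
  have hp : 2 ≤ p := (Fact.out : p.Prime).two_le
  have hpq : p ∣ q := hq ▸ dvd_pow_self p (by omega)
  have hq0 : 0 < q := hF ▸ Fintype.card_pos
  have hp_le := Nat.le_of_dvd hq0 hpq
  subst hF
  rcases lt_four_or_le_of_bounds hn hlow hwt with h4 | h29
  · obtain h2 | h3 : Fintype.card F = 2 ∨ Fintype.card F = 3 := by omega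
    · obtain rfl : p = 2 := by omega
      exact typeT_of_card_eq_two h2 hc hW hl hlW hl3
    · obtain rfl : p = 3 := by
        rw [h3] at hpq
        exact (Nat.prime_dvd_prime_iff_eq Fact.out Nat.prime_three).mp hpq
      refine typeT_of_card_eq_three hn h3 hc ?_ hW hl hlW hl3
      rw [B, if_pos (by omega), h3] at hwt
      have hw : wt c ≤ 2 * 3 ^ (n - 1) := by exact_mod_cast hwt
      rw [suppCard_eq, h3]
      omega
  · refine typeT_of_three_secant_of_large hn h29 hc ?_ hW hl hlW hl3
    rw [suppCard_eq, mul_assoc]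
    refine Nat.mul_le_mul_left _ ?_
    have h := hwt.trans (B_le_of_le hn h29)
    have h4 : (Fintype.card F : ℝ) - 4 = (Fintype.card F - 4 : ℕ) := by
      rw [Nat.cast_sub (by omega), Nat.cast_ofNat]
    rw [h4] at h
    exact_mod_cast h

end PGCode
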